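/- Suppose M is generalized Cohen-Macaulay. Then α(M) = Σ_{i=0}^{d} C(d,i) · dim_k Soc(H^i_m(M)), where C(d,i) denotes the binomial coefficient. -/

import Mathlib

open IsLocalRing

universe u

namespace Paper

variable (R : Type u) [CommRing R]

/-- `dim_{R/I} Soc_I(N)` where `Soc_I(N) = (0 :_N I)`. -/
noncomputable def socDim (I : Ideal R) (N : Type u) [AddCommGroup N] [Module R N] : ℕ :=
  Module.finrank (R ⧸ I) (Submodule.torsionBySet R N (I : Set R))

/-- Krull dimension of a module (`⊥` for the zero module). -/
noncomputable def mdim (M : Type u) [AddCommGroup M] [Module R M] : WithBot (WithTop ℕ) :=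
  ringKrullDim (R ⧸ Module.annihilator R M)

/-- The index of reducibility of an ideal `q` on `M`: `dim_k Soc (M/qM)`. -/
noncomputable def ir [IsLocalRing R] (M : Type u) [AddCommGroup M] [Module R M]
    (q : Ideal R) : ℕ :=
  socDim R (maximalIdeal R) (M ⧸ (q • ⊤ : Submodule R M))

/-- `dim_k Soc (H^i_m(M))`. -/
noncomputable def socH [IsLocalRing R] (M : Type u) [AddCommGroup M] [Module R M] (i : ℕ) : ℕ :=
  socDim R (maximalIdeal R) ((localCohomology (maximalIdeal R) i).obj (ModuleCat.of R M))

/-- A system of parameters of `M` (of length `d`): `d` elements of the maximal ideal such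
that the quotient has finite length. -/
def IsSOP [IsLocalRing R] (M : Type u) [AddCommGroup M] [Module R M] (d : ℕ)
    (x : Fin d → R) : Prop :=
  (∀ i, x i ∈ maximalIdeal R) ∧
    IsFiniteLength R (M ⧸ (Ideal.span (Set.range x) • ⊤ : Submodule R M))

/-- A parameter element: an element occurring in some system of parameters of `M`. -/
def IsParamElement [IsLocalRing R] (M : Type u) [AddCommGroup M] [Module R M] (d : ℕ)
    (a : R) : Prop :=
  ∃ x : Fin d → R, IsSOP R M d x ∧ ∃ i, x i = a

/-- The ideal `b(M) = ⋂ Ann (0 :_{M/(x_1,...,x_{i-1})M} x_i)`, the intersection running over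
all systems of parameters `x_1, ..., x_d` of `M`. -/
noncomputable def bIdeal [IsLocalRing R] (M : Type u) [AddCommGroup M] [Module R M]
    (d : ℕ) : Ideal R :=
  ⨅ (x : Fin d → R) (_ : IsSOP R M d x) (i : Fin d),
    Module.annihilator R
      (Submodule.torsionBy R (M ⧸ (Ideal.span (x '' {j | j < i}) • ⊤ : Submodule R M)) (x i))

/-- A C-system of parameters: `x_i ∈ b(M/(x_{i+1},...,x_d)M)^3` for all `i`. -/
def IsCSOP [IsLocalRing R] (M : Type u) [AddCommGroup M] [Module R M] (d : ℕ)
    (x : Fin d → R) : Prop :=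
  IsSOP R M d x ∧ ∀ i : Fin d,
    x i ∈ (bIdeal R (M ⧸ (Ideal.span (x '' {j | i < j}) • ⊤ : Submodule R M)) ((i : ℕ) + 1)) ^ 3

/-- The depth of `M`: the supremum of the lengths of `M`-regular sequences contained in the
maximal ideal. -/
noncomputable def depth [IsLocalRing R] (M : Type u) [AddCommGroup M] [Module R M] :
    WithTop ℕ :=
  sSup {n : WithTop ℕ | ∃ rs : List R, (rs.length : WithTop ℕ) = n ∧
    (∀ r ∈ rs, r ∈ maximalIdeal R) ∧ RingTheory.Sequence.IsRegular M rs}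

/-- `M` is a Cohen-Macaulay module: `depth M = dim M`. -/
def IsCM [IsLocalRing R] (M : Type u) [AddCommGroup M] [Module R M] : Prop :=
  (depth R M : WithBot (WithTop ℕ)) = mdim R M

/-- A Cohen-Macaulay local ring. -/
def IsCMLocalRing (S : Type u) [CommRing S] [IsLocalRing S] : Prop :=
  IsNoetherianRing S ∧ IsCM S S

/-- `R` is a homomorphic image of a Cohen-Macaulay (Noetherian) local ring. -/
def IsQuotientOfCMLocalRing : Prop :=
  ∃ (S : Type u) (_ : CommRing S) (_ : IsLocalRing S),
    IsCMLocalRing S ∧ ∃ f : S →+* R, Function.Surjective f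

/-- The largest submodule of (the submodule) `N` whose dimension is strictly smaller than
that of `N`. -/
noncomputable def uComp (M : Type u) [AddCommGroup M] [Module R M] (N : Submodule R M) :
    Submodule R M :=
  sSup {P : Submodule R M | P ≤ N ∧ mdim R P < mdim R N}

/-- The unmixed component `U_M(0)` of `M`: the largest submodule of dimension `< dim M`. -/
noncomputable def unmixedComp (M : Type u) [AddCommGroup M] [Module R M] : Submodule R M :=
  uComp R M ⊤

/-- The 0-th local cohomology `H^0_m(M)` realized as the submodule of elements annihilated by
some power of the maximal ideal. -/
def H0sub [IsLocalRing R] (M : Type u) [AddCommGroup M] [Module R M] : Submodule R M :=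
  ⨆ n : ℕ, Submodule.torsionBySet R M (((maximalIdeal R) ^ n : Ideal R) : Set R)

/-- The quotient `P/N` of two submodules of `M`. -/
abbrev subQuot (M : Type u) [AddCommGroup M] [Module R M] (P N : Submodule R M) :=
  P ⧸ (Submodule.comap P.subtype N)

/-- `D_0 ⊆ D_1 ⊆ ⋯ ⊆ D_t = M` is the dimension filtration of `M`:
`D_t = M`, each `D_{i-1}` is the largest submodule of `D_i` of strictly smaller dimension,
and `D_0 = H^0_m(M)`. -/
def IsDimFiltration [IsLocalRing R] (M : Type u) [AddCommGroup M] [Module R M]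
    (t : ℕ) (D : Fin (t + 1) → Submodule R M) : Prop :=
  D (Fin.last t) = ⊤ ∧ (∀ i : Fin t, D i.castSucc = uComp R M (D i.succ)) ∧
    D 0 = H0sub R M

/-- `M` is sequentially Cohen-Macaulay: all quotients `D_i/D_{i-1}` of the dimension
filtration are Cohen-Macaulay. -/
def IsSeqCM [IsLocalRing R] (M : Type u) [AddCommGroup M] [Module R M] : Prop :=
  ∃ (t : ℕ) (D : Fin (t + 1) → Submodule R M), IsDimFiltration R M t D ∧
    ∀ i : Fin t, IsCM R (subQuot R M (D i.succ) (D i.castSucc))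

/-- `M` (of dimension `d`) is generalized Cohen-Macaulay: `H^i_m(M)` has finite length
for all `i < d`. -/
def IsGenCM [IsLocalRing R] (M : Type u) [AddCommGroup M] [Module R M] (d : ℕ) : Prop :=
  ∀ i < d, IsFiniteLength R ((localCohomology (maximalIdeal R) i).obj (ModuleCat.of R M))

/-- `α_n(M)`: the minimum of the indices of reducibility of parameter ideals of `M`
contained in `m^n`. -/
noncomputable def alphaN [IsLocalRing R] (M : Type u) [AddCommGroup M] [Module R M]
    (d n : ℕ) : ℕ :=
  sInf {r : ℕ | ∃ x : Fin d → R, IsSOP R M d x ∧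
    Ideal.span (Set.range x) ≤ (maximalIdeal R) ^ n ∧ r = ir R M (Ideal.span (Set.range x))}

/-- The limit value `α(M) = lim_n α_n(M)` (the supremum of the non-decreasing sequence). -/
noncomputable def alphaLim [IsLocalRing R] (M : Type u) [AddCommGroup M] [Module R M]
    (d : ℕ) : ℕ :=
  ⨆ n : ℕ, alphaN R M d (n + 1)

/-- `M` is unmixed: `dim R/p = dim M` for all associated primes `p`. -/
def IsUnmixed (M : Type u) [AddCommGroup M] [Module R M] : Prop :=
  ∀ p ∈ associatedPrimes R M, ringKrullDim (R ⧸ p) = mdim R M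

/-- Serre's condition `(S_2)` for a module. -/
def IsS2 (L : Type u) [AddCommGroup L] [Module R L] : Prop :=
  ∀ p : PrimeSpectrum R, p ∈ Module.support R L →
    min 2 (mdim (Localization.AtPrime p.asIdeal) (LocalizedModule p.asIdeal.primeCompl L)) ≤
      (depth (Localization.AtPrime p.asIdeal) (LocalizedModule p.asIdeal.primeCompl L) :
        WithBot (WithTop ℕ))

/-- `ι : M →ₗ[R] S` exhibits `S` as an `S_2`-ification of `M`. -/
def IsS2ification [IsLocalRing R] (M S : Type u) [AddCommGroup M] [Module R M]
    [AddCommGroup S] [Module R S] (ι : M →ₗ[R] S) : Prop :=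
  Function.Injective ι ∧ Module.Finite R S ∧ IsS2 R S ∧
    ∀ (p : Ideal R) [p.IsPrime], p ≠ maximalIdeal R →
      IsS2 (Localization.AtPrime p) (LocalizedModule p.primeCompl M) →
      Function.Surjective (IsLocalizedModule.map p.primeCompl
        (LocalizedModule.mkLinearMap p.primeCompl M)
        (LocalizedModule.mkLinearMap p.primeCompl S) ι)

end Paper

namespace GCM

section soclen
variable {R : Type u} [CommRing R]

/-- Length of the socle of `N` with respect to `m`. -/
noncomputable def soclen (m : Ideal R) (N : Type u) [AddCommGroup N] [Module R N] : ℕ∞ :=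
  Module.length R (Submodule.torsionBySet R N (m : Set R))

lemma socDim_eq (m : Ideal R) [m.IsMaximal] (N : Type u) [AddCommGroup N] [Module R N] :
    Module.finrank (R ⧸ m) (Submodule.torsionBySet R N (m : Set R)) = (soclen m N).toNat := by
  let _ : Field (R ⧸ m) := Ideal.Quotient.field m
  have h : Module.length R (Submodule.torsionBySet R N (m : Set R)) =
      Module.length (R ⧸ m) (Submodule.torsionBySet R N (m : Set R)) :=
    Module.length_eq_of_surjective Ideal.Quotient.mk_surjective
  unfold soclen
  rw [h, Module.length_eq_rank]
  rfl

lemma soclen_congr (m : Ideal R) {N P : Type u} [AddCommGroup N] [Module R N] [AddCommGroup P]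
    [Module R P] (e : N ≃ₗ[R] P) : soclen m N = soclen m P := by
  apply LinearEquiv.length_eq
  refine LinearEquiv.ofSubmodules e _ _ ?_
  ext y
  simp only [Submodule.mem_map, Submodule.mem_torsionBySet_iff]
  constructor
  · rintro ⟨x, hx, rfl⟩ a
    have := hx a
    rw [← map_smul] 
    simp [this]
  · intro h
    refine ⟨e.symm y, fun a => ?_, by simp⟩
    rw [← map_smul]
    simp [h a]

lemma soclen_add (m : Ideal R) {A B C : Type u} [AddCommGroup A] [Module R A] [AddCommGroup B]
    [Module R B] [AddCommGroup C] [Module R C] (f : A →ₗ[R] B) (g : B →ₗ[R] C)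
    (hf : Function.Injective f) (hfg : Function.Exact f g)
    (hl : ∀ c ∈ Submodule.torsionBySet R C (m : Set R),
      ∃ b ∈ Submodule.torsionBySet R B (m : Set R), g b = c) :
    soclen m B = soclen m A + soclen m C := by
  have hf' : ∀ a ∈ Submodule.torsionBySet R A (m : Set R),
      f a ∈ Submodule.torsionBySet R B (m : Set R) := by
    intro a ha
    rw [Submodule.mem_torsionBySet_iff] at *
    intro r
    have := ha r
    rw [← map_smul]
    simp [this]
  have hg' : ∀ a ∈ Submodule.torsionBySet R B (m : Set R),
      g a ∈ Submodule.torsionBySet R C (m : Set R) := by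
    intro a ha
    rw [Submodule.mem_torsionBySet_iff] at *
    intro r
    have := ha r
    rw [← map_smul]
    simp [this]
  refine Module.length_eq_add_of_exact (f.restrict hf') (g.restrict hg') ?_ ?_ ?_
  · rintro ⟨a, ha⟩ ⟨b, hb⟩ h
    have h' := congrArg Subtype.val h
    exact Subtype.ext (hf h')
  · rintro ⟨c, hc⟩
    obtain ⟨b, hb, rfl⟩ := hl c hc
    exact ⟨⟨b, hb⟩, rfl⟩
  · rintro ⟨b, hb⟩
    constructor
    · intro h
      have h' : g b = 0 := congrArg Subtype.val h
      obtain ⟨a, rfl⟩ := (hfg b).1 h'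
      refine ⟨⟨a, ?_⟩, rfl⟩
      rw [Submodule.mem_torsionBySet_iff] at *
      intro r
      apply hf
      rw [LinearMap.map_smul_of_tower, map_zero]
      exact hb r
    · rintro ⟨⟨a, ha⟩, h⟩
      have h' : f a = b := congrArg Subtype.val h
      apply Subtype.ext
      change g b = 0
      rw [← h']
      exact (hfg _).2 ⟨a, rfl⟩

end soclen

/-- Bare-hands cochain complexes of `R`-modules indexed by `ℕ`. -/
structure Cpx (R : Type u) [CommRing R] where
  X : ℕ → Type u
  [grp : ∀ n, AddCommGroup (X n)]
  [mod : ∀ n, Module R (X n)]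
  d : ∀ n, X n →ₗ[R] X (n + 1)
  dd : ∀ n z, d (n + 1) (d n z) = 0

attribute [instance] Cpx.grp Cpx.mod

namespace Cpx

variable {R : Type u} [CommRing R]

/-- Cohomology at the index `n + 1`. -/
abbrev H (C : Cpx R) (n : ℕ) : Type u :=
  LinearMap.ker (C.d (n + 1)) ⧸ (LinearMap.range (C.d n)).comap (LinearMap.ker (C.d (n + 1))).subtype

/-- Class of a cocycle. -/
def cls (C : Cpx R) (n : ℕ) (z : C.X (n + 1)) (hz : C.d (n + 1) z = 0) : C.H n :=
  Submodule.Quotient.mk ⟨z, hz⟩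

lemma cls_eq_zero (C : Cpx R) (n : ℕ) (z : C.X (n + 1)) (hz : C.d (n + 1) z = 0) :
    C.cls n z hz = 0 ↔ ∃ e, C.d n e = z := by
  unfold cls
  rw [Submodule.Quotient.mk_eq_zero]
  rfl

lemma cls_surj (C : Cpx R) (n : ℕ) (h : C.H n) : ∃ z hz, C.cls n z hz = h := by
  obtain ⟨⟨z, hz⟩, rfl⟩ := Submodule.Quotient.mk_surjective _ h
  exact ⟨z, hz, rfl⟩

lemma smul_cls (C : Cpx R) (n : ℕ) (r : R) (z : C.X (n + 1)) (hz : C.d (n + 1) z = 0) :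
    r • C.cls n z hz = C.cls n (r • z) (by simp [hz]) := rfl

/-- Mapping cone of multiplication by `x`. -/
def cone (C : Cpx R) (x : R) : Cpx R where
  X n := C.X n × C.X (n + 1)
  d n := LinearMap.prod
    ((C.d n).comp (LinearMap.fst R _ _) - x • LinearMap.snd R _ _)
    (- (C.d (n + 1)).comp (LinearMap.snd R _ _))
  dd n z := by
    ext <;> simp [C.dd]

lemma cone_d (C : Cpx R) (x : R) (n : ℕ) (b : C.X n) (c : C.X (n + 1)) :
    (C.cone x).d n ((b, c) : C.X n × C.X (n + 1)) =
      ((C.d n b - x • c, - C.d (n + 1) c) : C.X (n + 1) × C.X (n + 2)) := rfl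

lemma cone_d_zero (C : Cpx R) (x : R) (n : ℕ) (b : C.X n) (c : C.X (n + 1)) :
    (C.cone x).d n ((b, c) : C.X n × C.X (n + 1)) = 0 ↔ C.d n b = x • c ∧ C.d (n + 1) c = 0 := by
  rw [cone_d]
  constructor
  · intro h
    have h1 := congrArg Prod.fst h
    have h2 := congrArg Prod.snd h
    exact ⟨sub_eq_zero.1 h1, neg_eq_zero.1 h2⟩
  · rintro ⟨h1, h2⟩
    rw [h1, h2]
    simp
    rfl

/-- Inclusion in the cone. -/
def coneF (C : Cpx R) (x : R) (n : ℕ) : C.H n →ₗ[R] (C.cone x).H n :=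
  Submodule.mapQ _ _
    (LinearMap.restrict (p := LinearMap.ker (C.d (n + 1))) (q := LinearMap.ker ((C.cone x).d (n + 1)))
      (LinearMap.inl R (C.X (n + 1)) (C.X (n + 2)))
      (fun b hb => (cone_d_zero C x _ _ _).2 ⟨by simpa using hb, by simp⟩))
    (by
      rintro ⟨z, hz⟩ ⟨e, he⟩
      change C.d n e = z at he
      refine ⟨((e, 0) : C.X n × C.X (n + 1)), ?_⟩
      rw [cone_d]
      simp [he]
      rfl)

lemma coneF_cls (C : Cpx R) (x : R) (n : ℕ) (z : C.X (n + 1)) (hz : C.d (n + 1) z = 0) :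
    C.coneF x n (C.cls n z hz) = (C.cone x).cls n ((z, 0) : C.X (n + 1) × C.X (n + 2))
      ((cone_d_zero C x _ _ _).2 ⟨by simpa using hz, by simp⟩) := rfl

/-- Projection from the cone. -/
def coneG (C : Cpx R) (x : R) (n : ℕ) : (C.cone x).H n →ₗ[R] C.H (n + 1) :=
  Submodule.mapQ _ _
    (LinearMap.restrict (p := LinearMap.ker ((C.cone x).d (n + 1))) (q := LinearMap.ker (C.d (n + 2)))
      (LinearMap.snd R (C.X (n + 1)) (C.X (n + 2)))
      (fun b hb => ((cone_d_zero C x _ b.1 b.2).1 hb).2))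
    (by
      rintro ⟨⟨z, z'⟩, hz⟩ ⟨⟨e, e'⟩, he⟩
      refine ⟨- e', ?_⟩
      have := congrArg Prod.snd he
      rw [map_neg]
      exact this)

lemma coneG_cls (C : Cpx R) (x : R) (n : ℕ) (b : C.X (n + 1)) (c : C.X (n + 2))
    (hz : (C.cone x).d (n + 1) ((b, c) : C.X (n + 1) × C.X (n + 2)) = 0) :
    C.coneG x n ((C.cone x).cls n ((b, c) : C.X (n + 1) × C.X (n + 2)) hz) =
      C.cls (n + 1) c (((cone_d_zero C x _ _ _).1 hz).2) := rfl

lemma cone_cls_surj (C : Cpx R) (x : R) (n : ℕ) (h : (C.cone x).H n) :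
    ∃ (b : C.X (n + 1)) (c : C.X (n + 2)) (h1 : C.d (n + 1) b = x • c) (h2 : C.d (n + 2) c = 0),
      (C.cone x).cls n ((b, c) : C.X (n + 1) × C.X (n + 2))
        ((cone_d_zero C x _ _ _).2 ⟨h1, h2⟩) = h := by
  obtain ⟨⟨b, c⟩, hz, rfl⟩ := cls_surj _ _ h
  exact ⟨b, c, ((cone_d_zero C x _ _ _).1 hz).1, ((cone_d_zero C x _ _ _).1 hz).2, rfl⟩

lemma cone_cls_eq_zero (C : Cpx R) (x : R) (n : ℕ) (b : C.X (n + 1)) (c : C.X (n + 2))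
    (hz : (C.cone x).d (n + 1) ((b, c) : C.X (n + 1) × C.X (n + 2)) = 0) :
    (C.cone x).cls n ((b, c) : C.X (n + 1) × C.X (n + 2)) hz = 0 ↔
      ∃ (e : C.X n) (f : C.X (n + 1)), C.d n e + x • f = b ∧ C.d (n + 1) f = c := by
  refine (cls_eq_zero (C.cone x) n _ hz).trans ?_
  constructor
  · rintro ⟨⟨e, f⟩, h⟩
    rw [cone_d] at h
    refine ⟨e, -f, ?_, ?_⟩
    · have h1 : C.d n e - x • f = b := congrArg Prod.fst h
      rw [← h1, smul_neg, sub_eq_add_neg]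
    · have h1 : -C.d (n + 1) f = c := congrArg Prod.snd h
      rw [← h1, map_neg]
  · rintro ⟨e, f, rfl, rfl⟩
    refine ⟨((e, -f) : C.X n × C.X (n + 1)), ?_⟩
    rw [cone_d]
    simp
    rfl

lemma cone_exact (C : Cpx R) (x : R) (n : ℕ) : Function.Exact (C.coneF x n) (C.coneG x n) := by
  intro h
  obtain ⟨b, c, h1, h2, rfl⟩ := cone_cls_surj C x n h
  rw [coneG_cls, cls_eq_zero]
  constructor
  · rintro ⟨e, rfl⟩
    refine ⟨C.cls n (b - x • e) (by simp [h1]), ?_⟩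
    rw [coneF_cls, ← sub_eq_zero]
    change (C.cone x).cls n (((b - x • e, 0) : C.X (n + 1) × C.X (n + 2)) -
      ((b, C.d (n + 1) e) : C.X (n + 1) × C.X (n + 2))) _ = 0
    simp only [Prod.mk_sub_mk]
    rw [cone_cls_eq_zero]
    exact ⟨0, -e, by simp, by simp⟩
  · rintro ⟨a, ha⟩
    obtain ⟨z, hz, rfl⟩ := cls_surj _ _ a
    rw [coneF_cls, ← sub_eq_zero] at ha
    change (C.cone x).cls n (((z, 0) : C.X (n + 1) × C.X (n + 2)) -
      ((b, c) : C.X (n + 1) × C.X (n + 2))) _ = 0 at ha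
    simp only [Prod.mk_sub_mk] at ha
    rw [cone_cls_eq_zero] at ha
    obtain ⟨e, f, -, hf⟩ := ha
    exact ⟨-f, by simp [hf]⟩

/-- The ideal `a` annihilates the cohomology at index `n + 1`. -/
def Kills (C : Cpx R) (a : Ideal R) (n : ℕ) : Prop :=
  ∀ y ∈ a, ∀ z, C.d (n + 1) z = 0 → ∃ e, C.d n e = y • z

lemma exists_lift (C : Cpx R) (a : Ideal R) (n : ℕ) (hk : C.Kills a n) (c : C.X (n + 2))
    (hc : ∀ y ∈ a, ∃ e, C.d (n + 1) e = y • c) (x : R) (hx : x ∈ a * a) :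
    ∃ b, C.d (n + 1) b = x • c ∧
      ∀ (r : R) e, C.d (n + 1) e = r • c → ∃ f, C.d n f = r • b - x • e := by
  induction hx using Submodule.mul_induction_on' with
  | mem_mul_mem y hy z hz =>
    obtain ⟨b, hb⟩ := hc y hy
    refine ⟨z • b, by rw [map_smul, hb, smul_smul, mul_comm], fun r e he => ?_⟩
    obtain ⟨f, hf⟩ := hk z hz (r • b - y • e) (by
      rw [map_sub, map_smul, map_smul, hb, he, smul_smul, smul_smul, mul_comm, sub_self])
    refine ⟨f, ?_⟩
    rw [hf, smul_sub, smul_smul, smul_smul, smul_smul, mul_comm z r, mul_comm z y]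
  | add x hx y hy ihx ihy =>
    obtain ⟨b, hb, hb'⟩ := ihx
    obtain ⟨b2, hb2, hb2'⟩ := ihy
    refine ⟨b + b2, by rw [map_add, hb, hb2, add_smul], fun r e he => ?_⟩
    obtain ⟨f, hf⟩ := hb' r e he
    obtain ⟨f2, hf2⟩ := hb2' r e he
    refine ⟨f + f2, ?_⟩
    rw [map_add, hf, hf2, smul_add, add_smul]
    abel

lemma Kills.cone {C : Cpx R} {a : Ideal R} {n : ℕ} (h1 : C.Kills a n) (h2 : C.Kills a (n + 1))
    {x : R} (hx : x ∈ a * a) : (C.cone x).Kills a n := by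
  rintro r hr ⟨b, c⟩ hz
  obtain ⟨hb, hc⟩ := (cone_d_zero C x _ _ _).1 hz
  obtain ⟨b0, hb0, hb0'⟩ := exists_lift C a n h1 c (fun y hy => h2 y hy c hc) x hx
  obtain ⟨g, hg⟩ := h1 r hr (b - b0) (by rw [map_sub, hb, hb0, sub_self])
  obtain ⟨e, he⟩ := h2 r hr c hc
  obtain ⟨f, hf⟩ := hb0' r e he
  refine ⟨((g + f, -e) : C.X n × C.X (n + 1)), ?_⟩
  rw [cone_d]
  apply Prod.ext
  · change C.d n (g + f) - x • (-e) = r • b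
    rw [map_add, hg, hf, smul_sub, smul_neg]
    abel
  · change - C.d (n + 1) (-e) = r • c
    rw [map_neg, neg_neg, he]

lemma soclen_cone (C : Cpx R) (m a : Ideal R) (ham : a ≤ m) (n : ℕ) (hk : C.Kills a n) (x : R)
    (hx : x ∈ a * a) :
    soclen m ((C.cone x).H n) = soclen m (C.H n) + soclen m (C.H (n + 1)) := by
  refine soclen_add m (C.coneF x n) (C.coneG x n) ?_ (C.cone_exact x n) ?_
  · rw [injective_iff_map_eq_zero]
    intro h hh
    obtain ⟨z, hz, rfl⟩ := cls_surj _ _ h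
    rw [coneF_cls, cone_cls_eq_zero] at hh
    obtain ⟨e, f, he, hf⟩ := hh
    rw [cls_eq_zero]
    obtain ⟨g, hg⟩ := hk x (Ideal.mul_le_left hx) f hf
    exact ⟨e + g, by rw [map_add, hg, he]⟩
  · intro h hh
    obtain ⟨c, hc, rfl⟩ := cls_surj _ _ h
    rw [Submodule.mem_torsionBySet_iff] at hh
    have hh' : ∀ y ∈ m, ∃ e, C.d (n + 1) e = y • c := by
      intro y hy
      have := hh ⟨y, hy⟩
      change y • _ = _ at this
      rw [smul_cls, cls_eq_zero] at this
      exact this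
    obtain ⟨b, hb, hb'⟩ := exists_lift C a n hk c (fun y hy => hh' y (ham hy)) x hx
    refine ⟨(C.cone x).cls n ((b, c) : C.X (n + 1) × C.X (n + 2))
        ((cone_d_zero C x _ _ _).2 ⟨hb, hc⟩), ?_, rfl⟩
    rw [Submodule.mem_torsionBySet_iff]
    rintro ⟨r, hr⟩
    refine (cone_cls_eq_zero C x n (r • b) (r • c)
      ((cone_d_zero C x _ _ _).2 ⟨by rw [map_smul, hb, smul_comm], by rw [map_smul, hc, smul_zero]⟩)).2 ?_
    obtain ⟨e, he⟩ := hh' r hr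
    obtain ⟨f, hf⟩ := hb' r e he
    exact ⟨f, e, by rw [hf]; abel, he⟩

lemma sum_choose_aux (k : ℕ) (f : ℕ → ℕ∞) :
    ∑ i ∈ Finset.range (k + 1), (k.choose i : ℕ∞) * f i +
      ∑ i ∈ Finset.range (k + 1), (k.choose i : ℕ∞) * f (i + 1) =
    ∑ i ∈ Finset.range (k + 1 + 1), ((k + 1).choose i : ℕ∞) * f i := by
  rw [Finset.sum_range_succ' _ (k + 1)]
  simp only [Nat.choose_succ_succ, Nat.cast_add, add_mul, Finset.sum_add_distrib]
  have h : ∑ i ∈ Finset.range (k + 1), (k.choose i : ℕ∞) * f i =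
      ∑ i ∈ Finset.range (k + 1), (k.choose (i + 1) : ℕ∞) * f (i + 1) + f 0 := by
    have h1 := Finset.sum_range_succ (fun i => (k.choose i : ℕ∞) * f i) (k + 1)
    rw [Finset.sum_range_succ'] at h1
    simp at h1
    simpa using h1.symm
  rw [h]
  simp
  abel

/-- Iterated cones (a Koszul complex). -/
def kos : List R → Cpx R → Cpx R
  | [], C => C
  | x :: l, C => kos l (C.cone x)

theorem soclen_kos (m a : Ideal R) (ham : a ≤ m) (l : List R) (hl : ∀ x ∈ l, x ∈ a * a)
    (C : Cpx R) (n : ℕ) (hk : ∀ i < l.length, C.Kills a (n + i)) :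
    soclen m ((kos l C).H n) =
      ∑ i ∈ Finset.range (l.length + 1), (l.length.choose i : ℕ∞) * soclen m (C.H (n + i)) := by
  induction l generalizing C with
  | nil =>
    simp only [List.length_nil, zero_add, Finset.range_one, Finset.sum_singleton]
    simp [kos]
    rfl
  | cons x l ih =>
    have hx := hl x (by simp)
    change soclen m ((kos l (C.cone x)).H n) = _
    rw [ih (fun y hy => hl y (by simp [hy]))]
    · have h1 : ∀ i ∈ Finset.range (l.length + 1),
          (l.length.choose i : ℕ∞) * soclen m ((C.cone x).H (n + i)) =
          (l.length.choose i : ℕ∞) * soclen m (C.H (n + i)) +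
          (l.length.choose i : ℕ∞) * soclen m (C.H (n + (i + 1))) := by
        intro i hi
        rw [soclen_cone C m a ham _ (hk i (by simpa using hi)) x hx, mul_add]
        rfl
      rw [Finset.sum_congr rfl h1, Finset.sum_add_distrib]
      exact sum_choose_aux l.length (fun i => soclen m (C.H (n + i)))
    · intro i hi
      exact (hk i (by simp; omega)).cone (hk (i + 1) (by simpa using hi)) hx

end Cpx

end GCM


namespace GCM

variable {R : Type u} [CommRing R]

/-- The `J`-torsion submodule. -/
def tors (J : Ideal R) (N : Type u) [AddCommGroup N] [Module R N] : Submodule R N where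
  carrier := {z | ∃ t : ℕ, ∀ r ∈ J ^ t, r • z = 0}
  zero_mem' := ⟨0, by simp⟩
  add_mem' := by
    rintro a b ⟨s, hs⟩ ⟨t, ht⟩
    refine ⟨s + t, fun r hr => ?_⟩
    rw [smul_add, hs r (Ideal.pow_le_pow_right (by omega) hr),
      ht r (Ideal.pow_le_pow_right (by omega) hr), add_zero]
  smul_mem' := by
    rintro c z ⟨t, ht⟩
    exact ⟨t, fun r hr => by rw [smul_comm, ht r hr, smul_zero]⟩

lemma mem_tors {J : Ideal R} {N : Type u} [AddCommGroup N] [Module R N] {z : N} :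
    z ∈ tors J N ↔ ∃ t : ℕ, ∀ r ∈ J ^ t, r • z = 0 := Iff.rfl

lemma map_tors (J : Ideal R) {N P : Type u} [AddCommGroup N] [Module R N] [AddCommGroup P]
    [Module R P] (f : N →ₗ[R] P) {z : N} (hz : z ∈ tors J N) : f z ∈ tors J P := by
  obtain ⟨t, ht⟩ := hz
  exact ⟨t, fun r hr => by rw [← map_smul, ht r hr, map_zero]⟩

lemma fg_tors (J : Ideal R) {N : Type u} [AddCommGroup N] [Module R N] (P : Submodule R N)
    (hP : P.FG) (h : P ≤ tors J N) : ∃ t : ℕ, ∀ r ∈ J ^ t, ∀ z ∈ P, r • z = 0 := by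
  obtain ⟨s, rfl⟩ := hP
  have h1 : ∀ z : N, ∃ t : ℕ, z ∈ s → ∀ r ∈ J ^ t, r • z = 0 := by
    intro z
    by_cases hz : z ∈ s
    · obtain ⟨t, ht⟩ := h (Submodule.subset_span hz)
      exact ⟨t, fun _ => ht⟩
    · exact ⟨0, fun h => (hz h).elim⟩
  choose t ht using h1
  refine ⟨s.sup t, fun r hr z hz => ?_⟩
  induction hz using Submodule.span_induction with
  | mem x hx => exact ht x hx r (Ideal.pow_le_pow_right (Finset.le_sup (f := t) hx) hr)
  | zero => simp
  | add x y _ _ hx hy => rw [smul_add, hx, hy, add_zero]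
  | smul a x _ hx => rw [smul_comm, hx, smul_zero]

lemma tors_quot [IsNoetherianRing R] (J : Ideal R) {N : Type u} [AddCommGroup N] [Module R N]
    (z : N) (t : ℕ) (h : ∀ r ∈ J ^ t, r • z ∈ tors J N) : z ∈ tors J N := by
  obtain ⟨s, hs⟩ := fg_tors J (Submodule.map (LinearMap.toSpanSingleton R N z) (J ^ t : Submodule R R))
    (Submodule.FG.map _ (IsNoetherian.noetherian (J ^ t : Submodule R R))) (by
      rintro _ ⟨r, hr, rfl⟩
      exact h r hr)
  refine ⟨s + t, fun r hr => ?_⟩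
  rw [pow_add] at hr
  induction hr using Submodule.mul_induction_on' with
  | mem_mul_mem a ha b hb =>
    rw [mul_smul]
    exact hs a ha _ ⟨b, hb, rfl⟩
  | add x hx y hy h1 h2 => rw [add_smul, h1, h2, add_zero]

lemma inj_retract {I A : Type u} [AddCommGroup I] [Module R I] [AddCommGroup A] [Module R A]
    (hI : Module.Injective R I) (s : A →ₗ[R] I) (q : I →ₗ[R] A) (h : ∀ a, q (s a) = a) :
    Module.Injective R A := by
  refine ⟨fun X Y _ _ _ _ f hf g => ?_⟩
  obtain ⟨k, hk⟩ := hI.out f hf (s ∘ₗ g)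
  exact ⟨q ∘ₗ k, fun x => by simp [hk, h]⟩

lemma inj_prod {A B : Type u} [AddCommGroup A] [Module R A] [AddCommGroup B] [Module R B]
    (hA : Module.Injective R A) (hB : Module.Injective R B) : Module.Injective R (A × B) := by
  refine ⟨fun X Y _ _ _ _ f hf g => ?_⟩
  obtain ⟨k, hk⟩ := hA.out f hf (LinearMap.fst R A B ∘ₗ g)
  obtain ⟨l, hl⟩ := hB.out f hf (LinearMap.snd R A B ∘ₗ g)
  exact ⟨k.prod l, fun x => by simp [hk, hl]⟩

lemma inj_quot {I : Type u} [AddCommGroup I] [Module R I] (N : Submodule R I)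
    (hI : Module.Injective R I) (hN : Module.Injective R N) : Module.Injective R (I ⧸ N) := by
  obtain ⟨ρ, hρ⟩ := hN.out N.subtype N.injective_subtype LinearMap.id
  refine inj_retract hI (N.liftQ (LinearMap.id - N.subtype ∘ₗ ρ) ?_) N.mkQ ?_
  · intro x hx
    have := hρ ⟨x, hx⟩
    simp only [Submodule.subtype_apply, LinearMap.id_apply] at this
    simp [this]
  · intro a
    obtain ⟨y, rfl⟩ := Submodule.Quotient.mk_surjective _ a
    simp

lemma inj_tors [IsNoetherianRing R] (J : Ideal R) {I : Type u} [AddCommGroup I] [Module R I]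
    (hI : Module.Injective R I) : Module.Injective R (tors J I) := by
  apply Module.Baer.injective
  intro K g
  obtain ⟨t, ht⟩ := fg_tors J (LinearMap.range ((tors J I).subtype ∘ₗ g))
    (by
      rw [LinearMap.range_eq_map]
      exact Submodule.FG.map _ (Module.Finite.fg_top))
    (by rintro _ ⟨x, rfl⟩; exact (g x).2)
  obtain ⟨k, hk⟩ := J.exists_pow_inf_eq_pow_smul (M := R) K
  have hAR : J ^ (k + t) ⊓ K ≤ J ^ t * K := by
    have := hk (k + t) (by omega)
    simp only [smul_eq_mul, Ideal.mul_top, Nat.add_sub_cancel_left] at this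
    rw [this]
    exact Ideal.mul_mono_right inf_le_right
  let S := J ^ (k + t)
  let π : K →ₗ[R] (R ⧸ S) := S.mkQ ∘ₗ K.subtype
  have hker : LinearMap.ker π ≤ LinearMap.ker g := by
    rintro ⟨x, hx⟩ hx'
    have hxS : x ∈ S := by
      exact (Submodule.Quotient.mk_eq_zero S).1 hx'
    have h2 : x ∈ J ^ t * K := hAR ⟨hxS, hx⟩
    have h3 : ∀ y, y ∈ J ^ t * K → ∃ hy : y ∈ K, g ⟨y, hy⟩ = 0 := by
      intro y hy
      induction hy using Submodule.mul_induction_on' with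
      | mem_mul_mem a ha b hb =>
        refine ⟨K.mul_mem_left a hb, ?_⟩
        have h4 : g (a • ⟨b, hb⟩) = 0 := by
          rw [map_smul]
          apply Subtype.ext
          exact ht a ha _ ⟨⟨b, hb⟩, rfl⟩
        exact h4
      | add x hx y hy h1 h2 =>
        obtain ⟨h1, h1'⟩ := h1
        obtain ⟨h2, h2'⟩ := h2
        refine ⟨K.add_mem h1 h2, ?_⟩
        have h4 : g (⟨x, h1⟩ + ⟨y, h2⟩) = 0 := by
          rw [map_add, h1', h2', add_zero]
        exact h4
    obtain ⟨_, h5⟩ := h3 x h2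
    exact h5
  let π' : (K ⧸ LinearMap.ker π) →ₗ[R] (R ⧸ S) := (LinearMap.ker π).liftQ π le_rfl
  have hπ' : Function.Injective π' := by
    rw [← LinearMap.ker_eq_bot]
    exact Submodule.ker_liftQ_eq_bot' _ _ rfl
  obtain ⟨h, hh⟩ := hI.out π' hπ' ((tors J I).subtype ∘ₗ (LinearMap.ker π).liftQ g hker)
  have h1 : h (S.mkQ 1) ∈ tors J I := by
    refine ⟨k + t, fun r hr => ?_⟩
    rw [← map_smul, ← map_smul]
    have : S.mkQ (r • 1) = 0 := by
      refine (Submodule.Quotient.mk_eq_zero S).2 ?_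
      rw [smul_eq_mul, mul_one]
      exact hr
    rw [this, map_zero]
  refine ⟨LinearMap.toSpanSingleton R _ ⟨_, h1⟩, fun x hx => ?_⟩
  apply Subtype.ext
  have := hh (Submodule.Quotient.mk ⟨x, hx⟩)
  change h (S.mkQ x) = (g ⟨x, hx⟩ : I) at this
  rw [← this]
  change x • h (S.mkQ 1) = _
  rw [← map_smul, ← map_smul, smul_eq_mul, mul_one]

namespace Cpx

lemma acyclic (J : Ideal R) (Q : Cpx R) (hinj : ∀ n, Module.Injective R (Q.X n))
    (h0 : Subsingleton (Q.X 0)) (htf : ∀ n, ∀ z ∈ tors J (Q.X n), z = 0)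
    (hH : ∀ n z, Q.d (n + 1) z = 0 → ∃ k : ℕ, ∀ r ∈ J ^ k, ∃ e, Q.d n e = r • z) :
    ∀ n z, Q.d (n + 1) z = 0 → ∃ e, Q.d n e = z := by
  have step : ∀ n, Module.Injective R (LinearMap.range (Q.d n)) →
      ∀ z, Q.d (n + 1) z = 0 → ∃ e, Q.d n e = z := by
    intro n hn z hz
    obtain ⟨ρ, hρ⟩ := hn.out (LinearMap.range (Q.d n)).subtype (Submodule.injective_subtype _)
      LinearMap.id
    obtain ⟨k, hk⟩ := hH n z hz
    have h1 : z - (ρ z : Q.X (n + 1)) = 0 := by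
      apply htf
      refine ⟨k, fun r hr => ?_⟩
      have h2 : ρ (r • z) = ⟨r • z, hk r hr⟩ := hρ ⟨r • z, hk r hr⟩
      rw [map_smul] at h2
      have h3 := congrArg Subtype.val h2
      rw [smul_sub, sub_eq_zero]
      exact h3.symm
    obtain ⟨e, he⟩ := (ρ z).2
    exact ⟨e, by rw [he]; exact (sub_eq_zero.1 h1).symm⟩
  have main : ∀ n, Module.Injective R (LinearMap.range (Q.d n)) := by
    intro n
    induction n with
    | zero =>
      have : Subsingleton (LinearMap.range (Q.d 0)) := by
        constructor
        rintro ⟨_, a, rfl⟩ ⟨_, b, rfl⟩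
        exact Subtype.ext (by rw [Subsingleton.elim a b])
      refine ⟨fun X Y _ _ _ _ f hf g => ⟨0, fun x => Subsingleton.elim _ _⟩⟩
    | succ n ih =>
      have hk : LinearMap.ker (Q.d (n + 1)) = LinearMap.range (Q.d n) := by
        ext z
        constructor
        · intro hz; exact step n ih z hz
        · rintro ⟨e, rfl⟩; exact Q.dd n e
      have h2 : Module.Injective R (Q.X (n + 1) ⧸ LinearMap.ker (Q.d (n + 1))) := by
        rw [hk]
        exact inj_quot _ (hinj _) ih
      let e := (Q.d (n + 1)).quotKerEquivRange
      exact inj_retract h2 e.symm.toLinearMap e.toLinearMap (by simp)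
  exact fun n => step n (main n)

/-- `C` is (via `f`) the `J`-torsion subcomplex of the complex of injectives `D`. -/
structure GPair (J : Ideal R) (C D : Cpx R) where
  f : ∀ n, C.X n →ₗ[R] D.X n
  comm : ∀ n z, f (n + 1) (C.d n z) = D.d n (f n z)
  inj : ∀ n, Function.Injective (f n)
  rng : ∀ n, LinearMap.range (f n) = tors J (D.X n)
  injD : ∀ n, Module.Injective R (D.X n)

/-- Cones of torsion pairs. -/
def GPair.cone {J : Ideal R} {C D : Cpx R} (P : GPair J C D) (x : R) :
    GPair J (C.cone x) (D.cone x) where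
  f n := LinearMap.prodMap (P.f n) (P.f (n + 1))
  comm := by
    rintro n ⟨b, c⟩
    change (P.f (n + 1) (C.d n b - x • c), P.f (n + 2) (- C.d (n + 1) c)) =
      (D.d n (P.f n b) - x • P.f (n + 1) c, - D.d (n + 1) (P.f (n + 1) c))
    simp [P.comm]
  inj n := by
    rintro ⟨a, b⟩ ⟨c, d⟩ h
    have h1 : P.f n a = P.f n c := congrArg Prod.fst h
    have h2 : P.f (n + 1) b = P.f (n + 1) d := congrArg Prod.snd h
    exact Prod.ext (P.inj _ h1) (P.inj _ h2)
  rng n := by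
    ext ⟨a, b⟩
    constructor
    · rintro ⟨⟨c, d⟩, h⟩
      have h1 : P.f n c = a := congrArg Prod.fst h
      have h2 : P.f (n + 1) d = b := congrArg Prod.snd h
      have h3 : a ∈ tors J _ := by rw [← P.rng, ← h1]; exact ⟨c, rfl⟩
      have h4 : b ∈ tors J _ := by rw [← P.rng, ← h2]; exact ⟨d, rfl⟩
      have h5 := (tors J (D.X n × D.X (n + 1))).add_mem (map_tors J (LinearMap.inl R _ _) h3)
        (map_tors J (LinearMap.inr R _ _) h4)
      have h6 : LinearMap.inl R (D.X n) (D.X (n + 1)) a + LinearMap.inr R (D.X n) (D.X (n + 1)) b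
          = (a, b) := by simp
      rw [h6] at h5
      exact h5
    · intro h
      have h3 : a ∈ tors J _ := map_tors J (LinearMap.fst R (D.X n) (D.X (n + 1))) h
      have h4 : b ∈ tors J _ := map_tors J (LinearMap.snd R (D.X n) (D.X (n + 1))) h
      rw [← P.rng] at h3 h4
      obtain ⟨c, rfl⟩ := h3
      obtain ⟨d, rfl⟩ := h4
      exact ⟨((c, d) : C.X n × C.X (n + 1)), rfl⟩
  injD n := inj_prod (P.injD _) (P.injD _)

/-- Iterated cones of torsion pairs. -/
def GPair.kos {J : Ideal R} : ∀ (l : List R) {C D : Cpx R} (_ : GPair J C D),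
    GPair J (kos l C) (kos l D)
  | [], _, _, P => P
  | x :: l, _, _, P => GPair.kos l (P.cone x)

lemma GPair.key [IsNoetherianRing R] {J : Ideal R} {C D : Cpx R} (P : GPair J C D)
    (h0 : Subsingleton (D.X 0)) (t : ℕ) (hk : ∀ n, D.Kills (J ^ t) n) (n : ℕ) (z : D.X (n + 1))
    (hz : D.d (n + 1) z ∈ tors J (D.X (n + 2))) :
    ∃ e, z - D.d n e ∈ tors J (D.X (n + 1)) := by
  let Q : Cpx R :=
    { X := fun n => D.X n ⧸ tors J (D.X n)
      d := fun n => Submodule.mapQ _ _ (D.d n) (fun z hz => map_tors J (D.d n) hz)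
      dd := by
        intro n z
        obtain ⟨z, rfl⟩ := Submodule.Quotient.mk_surjective _ z
        simp [D.dd] }
  have hac := acyclic J Q (fun n => inj_quot _ (P.injD n) (inj_tors J (P.injD n)))
    (by
      constructor
      intro a b
      obtain ⟨a, rfl⟩ := Submodule.Quotient.mk_surjective _ a
      obtain ⟨b, rfl⟩ := Submodule.Quotient.mk_surjective _ b
      rw [Subsingleton.elim a b])
    (by
      rintro n z ⟨s, hs⟩
      obtain ⟨z, rfl⟩ := Submodule.Quotient.mk_surjective _ z
      rw [Submodule.Quotient.mk_eq_zero]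
      refine tors_quot J z s (fun r hr => ?_)
      rw [← Submodule.Quotient.mk_eq_zero]
      exact hs r hr)
    (by
      intro n z hz
      obtain ⟨z, rfl⟩ := Submodule.Quotient.mk_surjective _ z
      have hz' : D.d (n + 1) z ∈ tors J (D.X (n + 2)) := by
        rw [← Submodule.Quotient.mk_eq_zero]
        exact hz
      obtain ⟨s, hs⟩ := hz'
      refine ⟨t + s, fun r hr => ?_⟩
      have : ∃ e, D.d n e = r • z := by
        rw [pow_add] at hr
        induction hr using Submodule.mul_induction_on' with
        | mem_mul_mem a ha b hb =>
          obtain ⟨e, he⟩ := hk n a ha (b • z) (by rw [map_smul, hs b hb])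
          exact ⟨e, by rw [he, mul_smul]⟩
        | add x hx y hy h1 h2 =>
          obtain ⟨e, he⟩ := h1
          obtain ⟨e', he'⟩ := h2
          exact ⟨e + e', by rw [map_add, he, he', add_smul]⟩
      obtain ⟨e, he⟩ := this
      refine ⟨Submodule.Quotient.mk e, ?_⟩
      rw [← Submodule.Quotient.mk_smul, ← he]
      rfl)
  obtain ⟨e, he⟩ := hac n (Submodule.Quotient.mk z) (by
    change Submodule.Quotient.mk (D.d (n + 1) z) = _
    rw [Submodule.Quotient.mk_eq_zero]
    exact hz)
  obtain ⟨e, rfl⟩ := Submodule.Quotient.mk_surjective _ e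
  refine ⟨e, ?_⟩
  change Submodule.Quotient.mk (D.d n e) = _ at he
  rw [← Submodule.Quotient.mk_eq_zero, Submodule.Quotient.mk_sub, he, sub_self]

theorem GPair.equiv [IsNoetherianRing R] {J : Ideal R} {C D : Cpx R} (P : GPair J C D)
    (h0 : Subsingleton (D.X 0)) (t : ℕ) (hk : ∀ n, D.Kills (J ^ t) n) (n : ℕ) :
    Nonempty (C.H n ≃ₗ[R] D.H n) := by
  let φ : C.H n →ₗ[R] D.H n := Submodule.mapQ _ _
    (LinearMap.restrict (p := LinearMap.ker (C.d (n + 1))) (q := LinearMap.ker (D.d (n + 1)))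
      (P.f (n + 1)) (fun b hb => by
        have hb' : C.d (n + 1) b = 0 := hb
        change D.d (n + 1) _ = 0
        rw [← P.comm, hb', map_zero]))
    (by
      rintro ⟨z, hz⟩ ⟨e, he⟩
      refine ⟨P.f n e, ?_⟩
      change C.d n e = z at he
      change D.d n _ = P.f (n + 1) z
      rw [← P.comm, he])
  have hφ : ∀ z hz, φ (C.cls n z hz) = D.cls n (P.f (n + 1) z)
    (by rw [← P.comm, hz, map_zero]) := fun z hz => rfl
  refine ⟨LinearEquiv.ofBijective φ ⟨?_, ?_⟩⟩
  · rw [injective_iff_map_eq_zero]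
    intro h hh
    obtain ⟨z, hz, rfl⟩ := cls_surj _ _ h
    rw [hφ, cls_eq_zero] at hh
    rw [cls_eq_zero]
    obtain ⟨e, he⟩ := hh
    cases n with
    | zero =>
      refine ⟨0, ?_⟩
      rw [map_zero]
      apply P.inj
      rw [map_zero, ← he, Subsingleton.elim e 0, map_zero]
    | succ k =>
      obtain ⟨e', he'⟩ := P.key h0 t hk k e (by
        rw [he, ← P.rng]
        exact ⟨z, rfl⟩)
      rw [← P.rng] at he'
      obtain ⟨c, hc⟩ := he'
      refine ⟨c, ?_⟩
      apply P.inj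
      rw [P.comm, hc, map_sub, D.dd, he, sub_zero]
  · intro h
    obtain ⟨z, hz, rfl⟩ := cls_surj _ _ h
    obtain ⟨e, he⟩ := P.key h0 t hk n z (by rw [hz]; exact Submodule.zero_mem _)
    rw [← P.rng] at he
    obtain ⟨c, hc⟩ := he
    refine ⟨C.cls n c ?_, ?_⟩
    · apply P.inj
      rw [P.comm, hc, map_sub, D.dd, hz, sub_zero, map_zero]
    · rw [hφ, ← sub_eq_zero]
      refine (cls_eq_zero D n (P.f (n + 1) c - z) (by
        rw [hc, map_sub, map_sub, D.dd, hz]; simp)).2 ⟨-e, ?_⟩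
      rw [hc, map_neg]
      abel

end Cpx
end GCM


namespace GCM
namespace Cpx

variable {R : Type u} [CommRing R]

/-- The annihilator of the cohomology. -/
def annH (D : Cpx R) : Ideal R where
  carrier := {y | ∀ n z, D.d (n + 1) z = 0 → ∃ e, D.d n e = y • z}
  zero_mem' := fun n z _ => ⟨0, by simp⟩
  add_mem' := by
    intro a b ha hb n z hz
    obtain ⟨e, he⟩ := ha n z hz
    obtain ⟨f, hf⟩ := hb n z hz
    exact ⟨e + f, by rw [map_add, he, hf, add_smul]⟩
  smul_mem' := by
    intro c a ha n z hz
    obtain ⟨e, he⟩ := ha n z hz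
    exact ⟨c • e, by rw [map_smul, he, smul_smul, smul_eq_mul]⟩

lemma mem_annH_cone_self (D : Cpx R) (x : R) : x ∈ (D.cone x).annH := by
  rintro n ⟨b, c⟩ hz
  obtain ⟨hb, hc⟩ := (cone_d_zero D x _ _ _).1 hz
  refine ⟨((0, -b) : D.X n × D.X (n + 1)), ?_⟩
  refine (cone_d D x n 0 (-b)).trans ?_
  apply Prod.ext
  · change D.d n 0 - x • (-b) = x • b
    simp
  · change - D.d (n + 1) (-b) = x • c
    simp [hb]

lemma mem_annH_cone (D : Cpx R) (x y : R) (hy : y ∈ D.annH) : y * y ∈ (D.cone x).annH := by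
  rintro n ⟨b, c⟩ hz
  obtain ⟨hb, hc⟩ := (cone_d_zero D x _ _ _).1 hz
  obtain ⟨e, he⟩ := hy (n + 1) c hc
  obtain ⟨f, hf⟩ := hy n (y • b - x • e) (by
    rw [map_sub, map_smul, map_smul, hb, he, smul_comm, sub_self])
  refine ⟨((f, -(y • e)) : D.X n × D.X (n + 1)), ?_⟩
  refine (cone_d D x n f _).trans ?_
  apply Prod.ext
  · change D.d n f - x • (-(y • e)) = (y * y) • b
    rw [hf, smul_neg, sub_neg_eq_add, smul_sub, smul_comm x y e, mul_smul]
    abel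
  · change - D.d (n + 1) (-(y • e)) = (y * y) • c
    simp [he, mul_smul]

lemma annH_kos (l : List R) (D : Cpx R) : D.annH ≤ (kos l D).annH.radical := by
  induction l generalizing D with
  | nil => exact Ideal.le_radical
  | cons x l ih =>
    intro y hy
    have h1 := ih (D.cone x) (mem_annH_cone D x y hy)
    rw [← pow_two] at h1
    exact (Ideal.mem_radical_of_pow_mem h1)

lemma mem_annH_kos (l : List R) (D : Cpx R) (x : R) (hx : x ∈ l) :
    x ∈ (kos l D).annH.radical := by
  induction l generalizing D with
  | nil => simp at hx
  | cons y l ih =>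
    rcases List.mem_cons.1 hx with rfl | h
    · exact annH_kos l _ (mem_annH_cone_self D x)
    · exact ih _ h

lemma kos_subsingleton (l : List R) (D : Cpx R) (n : ℕ)
    (h : ∀ k ≤ n + l.length, Subsingleton (D.X k)) :
    ∀ k ≤ n, Subsingleton ((kos l D).X k) := by
  induction l generalizing D with
  | nil => exact fun k hk => h k (by simpa using hk)
  | cons y l ih =>
    apply ih (D.cone y)
    intro k hk
    have h1 := h k (by simp; omega)
    have h2 := h (k + 1) (by simp; omega)
    change Subsingleton (D.X k × D.X (k + 1))
    infer_instance

lemma kos_quot {M : Type u} [AddCommGroup M] [Module R M] (l : List R) (D : Cpx R) (n : ℕ)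
    (φ : M →ₗ[R] D.H n) (hφ : Function.Surjective φ)
    (hs : ∀ i, Subsingleton (D.H (n + (i + 1)))) :
    ∃ ψ : M →ₗ[R] (kos l D).H n, Function.Surjective ψ ∧
      LinearMap.ker ψ = LinearMap.ker φ ⊔ (Ideal.span {y | y ∈ l} • ⊤ : Submodule R M) := by
  induction l generalizing D with
  | nil => exact ⟨φ, hφ, by simp; rfl⟩
  | cons x l ih =>
    obtain ⟨ψ, h1, h2⟩ := ih (D.cone x) (D.coneF x n ∘ₗ φ) (by
      intro h
      have hs0 : Subsingleton (D.H (n + 1)) := hs 0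
      obtain ⟨a, rfl⟩ := (D.cone_exact x n h).1 (Subsingleton.elim _ _)
      obtain ⟨m, rfl⟩ := hφ a
      exact ⟨m, rfl⟩) (by
      intro i
      have hs1 : Subsingleton (D.H (n + (i + 1))) := hs i
      have hs2 : Subsingleton (D.H (n + (i + 1) + 1)) := hs (i + 1)
      constructor
      have : ∀ h : (D.cone x).H (n + (i + 1)), h = 0 := by
        intro h
        obtain ⟨a, rfl⟩ := (D.cone_exact x _ h).1 (Subsingleton.elim _ _)
        rw [Subsingleton.elim a 0, map_zero]
      intro a b
      rw [this a, this b])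
    refine ⟨ψ, h1, h2.trans ?_⟩
    have h3 : LinearMap.ker (D.coneF x n ∘ₗ φ) =
        LinearMap.ker φ ⊔ (Ideal.span {x} • ⊤ : Submodule R M) := by
      apply le_antisymm
      · intro m hm
        obtain ⟨z, hz, hzm⟩ := cls_surj _ _ (φ m)
        have hm' : D.coneF x n (φ m) = 0 := hm
        rw [← hzm, coneF_cls, cone_cls_eq_zero] at hm'
        obtain ⟨e, f, he, hf⟩ := hm'
        obtain ⟨m', hm'⟩ := hφ (D.cls n f hf)
        have h4 : φ (m - x • m') = 0 := by
          rw [map_sub, map_smul, hm', ← hzm]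
          exact (cls_eq_zero D n (z - x • f) (by simp [hz, hf])).2 ⟨e, by rw [← he]; abel⟩
        have h5 : m = (m - x • m') + x • m' := by abel
        rw [h5]
        exact Submodule.add_mem_sup h4
          (Submodule.smul_mem_smul (Ideal.mem_span_singleton_self x) trivial)
      · refine sup_le ?_ ?_
        · intro m hm
          change D.coneF x n (φ m) = 0
          rw [LinearMap.mem_ker.1 hm, map_zero]
        · rw [Submodule.ideal_span_singleton_smul]
          rintro _ ⟨m, -, rfl⟩
          change D.coneF x n (φ (x • m)) = 0
          obtain ⟨z, hz, hzm⟩ := cls_surj _ _ (φ m)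
          rw [map_smul, ← hzm, smul_cls, coneF_cls, cone_cls_eq_zero]
          exact ⟨0, z, by simp, hz⟩
    rw [h3, sup_assoc, ← Submodule.sup_smul, ← Ideal.span_insert]
    congr 3
    ext y
    simp

end Cpx
end GCM


namespace GCM
namespace Cpx

variable {R : Type u} [CommRing R]

/-- Underlying modules of the shifted complex. -/
def shX (D : Cpx R) : ℕ → Type u
  | 0 => PUnit
  | n + 1 => D.X n

/-- The group structure on the shifted complex. -/
instance shGrp (D : Cpx R) : ∀ n, AddCommGroup (D.shX n)
  | 0 => (inferInstance : AddCommGroup PUnit.{u+1})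
  | n + 1 => D.grp n

/-- The module structure on the shifted complex. -/
instance shMod (D : Cpx R) : ∀ n, Module R (D.shX n)
  | 0 => (inferInstance : Module R PUnit.{u+1})
  | n + 1 => D.mod n

/-- The differential of the shifted complex. -/
def shD (D : Cpx R) : ∀ n, D.shX n →ₗ[R] D.shX (n + 1)
  | 0 => 0
  | n + 1 => D.d n

/-- The shifted complex. -/
def shift (D : Cpx R) : Cpx R where
  X := D.shX
  d := D.shD
  dd := by
    intro n z
    cases n with
    | zero => exact map_zero (D.d 0)
    | succ n => exact D.dd n z

lemma shift_kills (D : Cpx R) (a : Ideal R) (n : ℕ) (h : D.Kills a n) : D.shift.Kills a (n + 1) :=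
  h

/-- Torsion pairs can be shifted. -/
def GPair.shift {J : Ideal R} {C D : Cpx R} (P : GPair J C D) : GPair J C.shift D.shift where
  f n := match n with
    | 0 => LinearMap.id
    | n + 1 => P.f n
  comm n := match n with
    | 0 => fun z => (map_zero (P.f 0))
    | n + 1 => P.comm n
  inj n := match n with
    | 0 => fun _ _ h => h
    | n + 1 => P.inj n
  rng n := match n with
    | 0 => by
      ext z
      constructor
      · intro _
        exact ⟨0, fun r _ => rfl⟩
      · intro _
        exact ⟨z, rfl⟩
    | n + 1 => P.rng n
  injD n := match n with
    | 0 => ⟨fun X Y _ _ _ _ f hf g => ⟨0, fun x => rfl⟩⟩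
    | n + 1 => P.injD n

/-- Iterated shift. -/
def shiftN : ℕ → Cpx R → Cpx R
  | 0, D => D
  | k + 1, D => (shiftN k D).shift

/-- Torsion pairs can be shifted. -/
def GPair.shiftN {J : Ideal R} {C D : Cpx R} (P : GPair J C D) :
    ∀ k, GPair J (shiftN k C) (shiftN k D)
  | 0 => P
  | k + 1 => (GPair.shiftN P k).shift

lemma shiftN_H (D : Cpx R) (k n : ℕ) : Nonempty ((shiftN k D).H (n + k) ≃ₗ[R] D.H n) := by
  induction k with
  | zero => exact ⟨LinearEquiv.refl _ _⟩
  | succ k ih =>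
    obtain ⟨e⟩ := ih
    exact ⟨e⟩

lemma shiftN_H' (D : Cpx R) (k n : ℕ) : Nonempty ((shiftN k D).H (k + n) ≃ₗ[R] D.H n) := by
  rw [add_comm]
  exact shiftN_H D k n

lemma shiftN_kills (D : Cpx R) (a : Ideal R) (k n : ℕ) (h : D.Kills a n) :
    (shiftN k D).Kills a (k + n) := by
  rw [add_comm]
  induction k with
  | zero => exact h
  | succ k ih => exact ih

lemma shiftN_subsingleton (D : Cpx R) (h0 : Subsingleton (D.X 0)) (k : ℕ) :
    ∀ j ≤ k, Subsingleton ((shiftN k D).X j) := by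
  induction k with
  | zero =>
    intro j hj
    obtain rfl : j = 0 := by omega
    exact h0
  | succ k ih =>
    intro j hj
    cases j with
    | zero => exact inferInstanceAs (Subsingleton PUnit)
    | succ j => exact ih j (by omega)

lemma shiftN_annH (D : Cpx R) (h0 : Subsingleton (D.X 0)) (k : ℕ) :
    D.annH ≤ (shiftN k D).annH := by
  induction k with
  | zero => exact le_rfl
  | succ k ih =>
    intro y hy n z hz
    cases n with
    | zero =>
      have := shiftN_subsingleton D h0 k 0 (by omega)
      exact ⟨0, Subsingleton.elim (α := (Cpx.shiftN k D).X 0) _ _⟩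
    | succ n => exact ih hy n z hz

theorem core [IsNoetherianRing R] (m : Ideal R) (E C : Cpx R) (P : GPair m C E)
    (h0 : Subsingleton (E.X 0)) {M : Type u} [AddCommGroup M] [Module R M] (φ : M ≃ₗ[R] E.H 0)
    (hs : ∀ i, Subsingleton (E.H (i + 1))) (a : Ideal R) (ha : a ≤ m) (l : List R)
    (hl : ∀ x ∈ l, x ∈ a * a) (hk : ∀ i < l.length, C.Kills a i)
    (hfin : m ≤ (Module.annihilator R M ⊔ Ideal.span {y | y ∈ l}).radical) :
    soclen m (M ⧸ (Ideal.span {y | y ∈ l} • ⊤ : Submodule R M)) =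
      ∑ i ∈ Finset.range (l.length + 1), (l.length.choose i : ℕ∞) * soclen m (C.H i) := by
  set k := l.length with hkl
  have hann : Module.annihilator R M ≤ E.annH := by
    intro y hy n z hz
    rw [← cls_eq_zero E n (y • z) (by simp [hz]), ← smul_cls E n y z hz]
    cases n with
    | zero =>
      obtain ⟨x, hx⟩ := φ.surjective (E.cls 0 z hz)
      rw [← hx, ← map_smul, Module.mem_annihilator.1 hy, map_zero]
    | succ n =>
      have := hs n
      exact Subsingleton.elim _ _
  have h1 : m ≤ (kos l (Cpx.shiftN k E)).annH.radical := by
    refine hfin.trans ?_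
    rw [Ideal.radical_le_radical_iff]
    refine sup_le ?_ ?_
    · exact hann.trans ((shiftN_annH E h0 k).trans (annH_kos l _))
    · rw [Ideal.span_le]
      exact fun x hx => mem_annH_kos l _ x hx
  obtain ⟨t, ht⟩ := Ideal.exists_pow_le_of_le_radical_of_fg h1 (IsNoetherian.noetherian _)
  have hX0 : Subsingleton ((kos l (Cpx.shiftN k E)).X 0) :=
    kos_subsingleton l _ 0 (fun j hj => shiftN_subsingleton E h0 k j (by omega)) 0 le_rfl
  obtain ⟨e⟩ := GPair.equiv (GPair.kos l (P.shiftN k)) hX0 t (fun n y hy => ht hy n) k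
  obtain ⟨e0⟩ := shiftN_H' E k 0
  obtain ⟨ψ, hψ, hψk⟩ := kos_quot l (Cpx.shiftN k E) k (M := M)
    ((φ.trans e0.symm).toLinearMap) (φ.trans e0.symm).surjective (by
      intro i
      obtain ⟨e1⟩ := shiftN_H' E k (i + 1)
      have := hs i
      exact e1.toEquiv.subsingleton)
  have hker : LinearMap.ker (φ.trans e0.symm).toLinearMap = ⊥ := LinearEquiv.ker _
  rw [hker, bot_sup_eq] at hψk
  rw [← hψk, soclen_congr m (ψ.quotKerEquivOfSurjective hψ), ← soclen_congr m e,
    soclen_kos m a ha l hl _ k (fun i hi => shiftN_kills C a k i (hk i hi))]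
  refine Finset.sum_congr rfl (fun i hi => ?_)
  obtain ⟨e2⟩ := shiftN_H' C k i
  rw [soclen_congr m e2]

end Cpx
end GCM


namespace GCM
open CategoryTheory CategoryTheory.Limits Opposite

variable {R : Type u} [CommRing R]

/-- `Hom(-, M)` as a functor to the opposite category. -/
noncomputable abbrev yF (M : ModuleCat.{u} R) : ModuleCat.{u} R ⥤ (ModuleCat.{u} R)ᵒᵖ :=
  ((linearYoneda R (ModuleCat.{u} R)).obj M).rightOp

/-- `Hom(P, M)` as a chain complex in the opposite category. -/
noncomputable abbrev yC {L : ModuleCat.{u} R} (P : ProjectiveResolution L) (M : ModuleCat.{u} R) :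
    ChainComplex (ModuleCat.{u} R)ᵒᵖ ℕ :=
  ((yF M).mapHomologicalComplex _).obj P.complex

/-- Cocycles. -/
noncomputable abbrev Zp {L : ModuleCat.{u} R} (P : ProjectiveResolution L) (M : ModuleCat.{u} R)
    (i : ℕ) : ModuleCat.{u} R := ((yC P M).opcycles i).unop

/-- Inclusion of cocycles. -/
noncomputable def jp {L : ModuleCat.{u} R} (P : ProjectiveResolution L) (M : ModuleCat.{u} R)
    (i : ℕ) : Zp P M i →ₗ[R] (P.complex.X i ⟶ M) := ((yC P M).pOpcycles i).unop.hom

/-- Projection of cocycles to `Ext`. -/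
noncomputable def vp {L : ModuleCat.{u} R} (P : ProjectiveResolution L) (M : ModuleCat.{u} R)
    (i : ℕ) : Zp P M i →ₗ[R] ((Ext R (ModuleCat.{u} R) i).obj (op L)).obj M :=
  ((P.isoLeftDerivedObj (yF M) i).hom ≫ (yC P M).homologyι i).unop.hom

lemma jp_inj {L : ModuleCat.{u} R} (P : ProjectiveResolution L) (M : ModuleCat.{u} R)
    (i : ℕ) : Function.Injective (jp P M i) := by
  have : Mono ((yC P M).pOpcycles i).unop := inferInstance
  exact (ModuleCat.mono_iff_injective _).1 this

lemma vp_surj {L : ModuleCat.{u} R} (P : ProjectiveResolution L) (M : ModuleCat.{u} R)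
    (i : ℕ) : Function.Surjective (vp P M i) := by
  have h1 : Mono ((yC P M).homologyι i) := inferInstance
  have h2 : Mono ((P.isoLeftDerivedObj (yF M) i).hom ≫ (yC P M).homologyι i) :=
    mono_comp' inferInstance h1
  have : Epi ((P.isoLeftDerivedObj (yF M) i).hom ≫ (yC P M).homologyι i).unop :=
    unop_epi_of_mono _
  exact (ModuleCat.epi_iff_surjective _).1 this

lemma jp_cocycle {L : ModuleCat.{u} R} (P : ProjectiveResolution L) (M : ModuleCat.{u} R)
    (i : ℕ) (c : Zp P M i) : P.complex.d (i + 1) i ≫ jp P M i c = 0 := by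
  have h := (yC P M).d_pOpcycles (i + 1) i
  have h2 := congrArg (fun f => f.unop.hom c) h
  exact h2

lemma jp_surj {L : ModuleCat.{u} R} (P : ProjectiveResolution L) (M : ModuleCat.{u} R)
    (i : ℕ) (g : P.complex.X i ⟶ M) (hg : P.complex.d (i + 1) i ≫ g = 0) :
    ∃ c, jp P M i c = g := by
  have hc := (yC P M).opcyclesIsCokernel (i + 1) i (by simp)
  have hex : (ShortComplex.mk _ _ ((yC P M).d_pOpcycles (i + 1) i)).Exact :=
    ShortComplex.exact_of_g_is_cokernel _ hc
  have := (ShortComplex.ShortExact.moduleCat_exact_iff_function_exact _).1 hex.unop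
  exact (this g).1 hg

lemma vp_zero {L : ModuleCat.{u} R} (P : ProjectiveResolution L) (M : ModuleCat.{u} R)
    (i : ℕ) (c : Zp P M i) : vp P M i c = 0 ↔
      ∃ b : P.complex.X ((ComplexShape.down ℕ).next i) ⟶ M,
        P.complex.d i ((ComplexShape.down ℕ).next i) ≫ b = jp P M i c := by
  have hc := (yC P M).homologyIsKernel i _ rfl
  have hex : (ShortComplex.mk _ _ ((yC P M).homologyι_comp_fromOpcycles i
      ((ComplexShape.down ℕ).next i))).Exact :=
    ShortComplex.exact_of_f_is_kernel _ hc
  have hfe := (ShortComplex.ShortExact.moduleCat_exact_iff_function_exact _).1 hex.unop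
  have h1 : vp P M i c = 0 ↔ ((yC P M).homologyι i).unop.hom c = 0 := by
    have h2 : vp P M i c =
      (P.isoLeftDerivedObj (yF M) i).unop.hom.hom (((yC P M).homologyι i).unop.hom c) := rfl
    rw [h2]
    constructor
    · intro h
      have h3 := congrArg (P.isoLeftDerivedObj (yF M) i).unop.inv.hom h
      have h5 := LinearMap.map_zero (P.isoLeftDerivedObj (yF M) i).unop.inv.hom
      have h4 := congrArg (fun f => f.hom (((yC P M).homologyι i).unop.hom c))
        (P.isoLeftDerivedObj (yF M) i).unop.hom_inv_id
      exact h4.symm.trans (h3.trans h5)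
    · intro h
      exact (congrArg (P.isoLeftDerivedObj (yF M) i).unop.hom.hom h).trans
        (LinearMap.map_zero _)
  have hp := (yC P M).p_fromOpcycles i ((ComplexShape.down ℕ).next i)
  have hp' : ∀ b, jp P M i (((yC P M).fromOpcycles i ((ComplexShape.down ℕ).next i)).unop.hom b) =
      P.complex.d i ((ComplexShape.down ℕ).next i) ≫ b :=
    fun b => congrArg (fun f => f.unop.hom b) hp
  rw [h1]
  refine (hfe c).trans ?_
  constructor
  · rintro ⟨b, rfl⟩
    exact ⟨b, (hp' b).symm⟩
  · rintro ⟨b, hb⟩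
    refine ⟨b, jp_inj P M i ?_⟩
    exact (hp' b).trans hb

lemma vp_nat {L L' : ModuleCat.{u} R} (h : L' ⟶ L) (P' : ProjectiveResolution L')
    (P : ProjectiveResolution L) (φ : ProjectiveResolution.Hom P' P h)
    (M : ModuleCat.{u} R) (i : ℕ) (c : Zp P M i) :
    ∃ c' : Zp P' M i, jp P' M i c' = φ.hom.f i ≫ jp P M i c ∧
      vp P' M i c' = (((Ext R (ModuleCat.{u} R) i).map h.op).app M).hom (vp P M i c) := by
  let ψ := ((yF M).mapHomologicalComplex (ComplexShape.down ℕ)).map φ.hom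
  refine ⟨(HomologicalComplex.opcyclesMap ψ i).unop.hom c, ?_, ?_⟩
  · have h1 := HomologicalComplex.p_opcyclesMap ψ i
    have h2 := congrArg (fun f => f.unop.hom c) h1
    exact h2
  · have h1 := ProjectiveResolution.isoLeftDerivedObj_hom_naturality h P' P φ.hom
      (by simpa using φ.hom_f_zero_comp_π_f_zero) (yF M) i
    have h2 := HomologicalComplex.homologyι_naturality ψ i
    have h3 : (P'.isoLeftDerivedObj (yF M) i).hom ≫ (yC P' M).homologyι i ≫
        HomologicalComplex.opcyclesMap ψ i = ((yF M).leftDerived i).map h ≫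
        (P.isoLeftDerivedObj (yF M) i).hom ≫ (yC P M).homologyι i := by
      refine (congrArg (fun f => (P'.isoLeftDerivedObj (yF M) i).hom ≫ f) h2.symm).trans ?_
      refine (Category.assoc _ _ _).symm.trans ?_
      refine (congrArg (fun f => f ≫ (yC P M).homologyι i) h1.symm).trans ?_
      exact Category.assoc _ _ _
    have h4 := congrArg (fun f => f.unop.hom c) h3
    exact h4

end GCM


namespace GCM
open CategoryTheory CategoryTheory.Limits Opposite

variable {R : Type u} [CommRing R]

/-- Two surjections with the same kernel have isomorphic targets. -/
lemma exists_equiv_of_ker {Z A B : Type*} [AddCommGroup Z] [AddCommGroup A] [AddCommGroup B]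
    [Module R Z] [Module R A] [Module R B] (v : Z →ₗ[R] A) (w : Z →ₗ[R] B)
    (hv : Function.Surjective v) (hw : Function.Surjective w)
    (h : ∀ z, v z = 0 ↔ w z = 0) : ∃ e : A ≃ₗ[R] B, ∀ z, e (v z) = w z := by
  have hk : LinearMap.ker v = LinearMap.ker w := by
    ext z; simpa using h z
  let e1 := v.quotKerEquivOfSurjective hv
  let e2 := w.quotKerEquivOfSurjective hw
  refine ⟨e1.symm.trans ((Submodule.quotEquivOfEq _ _ hk).trans e2), fun z => ?_⟩
  have h1 : e1.symm (v z) = Submodule.Quotient.mk z := by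
    rw [LinearEquiv.symm_apply_eq]; rfl
  rw [LinearEquiv.trans_apply, h1]
  rfl

lemma projExtMk_zero_iff {L : ModuleCat.{u} R} (P : ProjectiveResolution L) {M : ModuleCat.{u} R}
    (f : P.complex.X 0 ⟶ M) (m : ℕ) (hm : 0 + 1 = m) (hf : P.complex.d m 0 ≫ f = 0) :
    P.extMk f m hm hf = 0 ↔ f = 0 := by
  constructor
  · intro h
    have h1 := congrArg P.extEquivCohomologyClass h
    rw [P.extEquivCohomologyClass_extMk, P.extEquivCohomologyClass_zero,
      CochainComplex.HomComplex.CohomologyClass.mk_eq_zero_iff,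
      CochainComplex.HomComplex.Cocycle.toSingleMk_mem_coboundaries_iff _ _ _ _ _ 1 (by simp)] at h1
    obtain ⟨g, hg⟩ := h1
    have hz : IsZero (P.cochainComplex.X 1) := CochainComplex.isZero_of_isStrictlyLE _ 0 _
    rw [hz.eq_of_src g 0, comp_zero] at hg
    rw [← cancel_epi (P.cochainComplexXIso (-(0 : ℕ)) 0 rfl).hom, comp_zero]
    exact hg.symm
  · rintro rfl
    exact P.extMk_zero _ _

lemma injExtMk_zero_iff {M : ModuleCat.{u} R} (I : InjectiveResolution M) {L : ModuleCat.{u} R}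
    (f : L ⟶ I.cocomplex.X 0) (m : ℕ) (hm : 0 + 1 = m) (hf : f ≫ I.cocomplex.d 0 m = 0) :
    I.extMk f m hm hf = 0 ↔ f = 0 := by
  constructor
  · intro h
    have h1 := congrArg I.extEquivCohomologyClass h
    rw [I.extEquivCohomologyClass_extMk, I.extEquivCohomologyClass_zero,
      CochainComplex.HomComplex.CohomologyClass.mk_eq_zero_iff,
      CochainComplex.HomComplex.Cocycle.fromSingleMk_mem_coboundaries_iff _ _ _ _ _ (-1)
        (by simp)] at h1
    obtain ⟨g, hg⟩ := h1
    have hz : IsZero (I.cochainComplex.X (-1)) :=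
      CochainComplex.isZero_of_isStrictlyGE _ 0 _
    rw [hz.eq_of_tgt g 0, zero_comp] at hg
    rw [← cancel_mono (I.cochainComplexXIso (0 : ℕ) 0 rfl).inv, zero_comp]
    exact hg.symm
  · rintro rfl
    exact I.extMk_zero _ _

/-- Class of a cocycle in the new `Ext`. -/
noncomputable def up {L : ModuleCat.{u} R} (P : ProjectiveResolution L) (M : ModuleCat.{u} R)
    (i : ℕ) : Zp P M i →ₗ[R] Abelian.Ext L M i where
  toFun c := P.extMk (jp P M i c) (i + 1) rfl (jp_cocycle P M i c)
  map_add' a b := by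
    rw [ProjectiveResolution.add_extMk]
    congr 1
    exact (jp P M i).map_add a b
  map_smul' r a := by
    rw [RingHom.id_apply, Abelian.Ext.smul_eq_comp_mk₀, ProjectiveResolution.extMk_comp_mk₀]
    congr 1
    rw [Linear.comp_smul, Category.comp_id]
    exact (jp P M i).map_smul r a

lemma up_apply {L : ModuleCat.{u} R} (P : ProjectiveResolution L) (M : ModuleCat.{u} R)
    (i : ℕ) (c : Zp P M i) :
    up P M i c = P.extMk (jp P M i c) (i + 1) rfl (jp_cocycle P M i c) := rfl

lemma up_surj {L : ModuleCat.{u} R} (P : ProjectiveResolution L) (M : ModuleCat.{u} R)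
    (i : ℕ) : Function.Surjective (up P M i) := by
  intro a
  obtain ⟨f, hf, rfl⟩ := P.extMk_surjective a (i + 1) rfl
  obtain ⟨c, rfl⟩ := jp_surj P M i f hf
  exact ⟨c, rfl⟩

lemma up_zero {L : ModuleCat.{u} R} (P : ProjectiveResolution L) (M : ModuleCat.{u} R)
    (i : ℕ) (c : Zp P M i) : vp P M i c = 0 ↔ up P M i c = 0 := by
  rw [vp_zero, up_apply]
  cases i with
  | zero =>
    rw [projExtMk_zero_iff, P.complex.shape 0 _ (by simp)]
    simp only [zero_comp, exists_const]
    exact eq_comm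
  | succ p =>
    have hn : (ComplexShape.down ℕ).next (p + 1) = p := ChainComplex.next_nat_succ p
    rw [ProjectiveResolution.extMk_eq_zero_iff _ _ _ _ _ p rfl, hn]

lemma exists_beta (L M : ModuleCat.{u} R) (i : ℕ) :
    ∃ e : ((Ext R (ModuleCat.{u} R) i).obj (op L)).obj M ≃ₗ[R] Abelian.Ext L M i,
      ∀ c, e (vp (ProjectiveResolution.of L) M i c) = up (ProjectiveResolution.of L) M i c :=
  exists_equiv_of_ker _ _ (vp_surj _ M i) (up_surj _ M i) (up_zero _ M i)

/-- Comparison of the two versions of `Ext`. -/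
noncomputable def beta (L M : ModuleCat.{u} R) (i : ℕ) :
    ((Ext R (ModuleCat.{u} R) i).obj (op L)).obj M ≃ₗ[R] Abelian.Ext L M i :=
  (exists_beta L M i).choose

lemma beta_nat {L L' : ModuleCat.{u} R} (h : L' ⟶ L) (M : ModuleCat.{u} R) (i : ℕ)
    (x : ((Ext R (ModuleCat.{u} R) i).obj (op L)).obj M) :
    beta L' M i ((((Ext R (ModuleCat.{u} R) i).map h.op).app M).hom x) =
      (Abelian.Ext.mk₀ h).comp (beta L M i x) (zero_add _) := by
  obtain ⟨c, rfl⟩ := vp_surj (ProjectiveResolution.of L) M i x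
  let P' := ProjectiveResolution.of L'
  let P := ProjectiveResolution.of L
  let φ : ProjectiveResolution.Hom P' P h :=
    { hom := ProjectiveResolution.lift h P' P
      hom_f_zero_comp_π_f_zero := by
        have := congrArg (fun f => f.f 0) (ProjectiveResolution.lift_commutes h P' P)
        exact this }
  obtain ⟨c', h1, h2⟩ := vp_nat h P' P φ M i c
  have e1 := (exists_beta L M i).choose_spec c
  have e2 := (exists_beta L' M i).choose_spec c'
  have e3 : beta L' M i (vp P' M i c') = (Abelian.Ext.mk₀ h).comp (beta L M i (vp P M i c))
      (zero_add _) := by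
    refine e2.trans ?_
    refine Eq.trans ?_ (congrArg (fun y => (Abelian.Ext.mk₀ h).comp y (zero_add _)) e1).symm
    rw [up_apply, up_apply, ProjectiveResolution.mk₀_comp_extMk _ _ _ _ φ]
    congr 1
  exact (congrArg (beta L' M i) h2).symm.trans e3

end GCM


namespace GCM
open CategoryTheory CategoryTheory.Limits Opposite

variable {R : Type u} [CommRing R]

/-- The transition map `R/J^m → R/J^n`. -/
noncomputable def qmap (J : Ideal R) {n m : ℕ} (h : n ≤ m) :
    ModuleCat.of R (R ⧸ J ^ m) ⟶ ModuleCat.of R (R ⧸ J ^ n) :=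
  ModuleCat.ofHom (Submodule.mapQ _ _ LinearMap.id (Ideal.pow_le_pow_right h))

/-- The canonical map to local cohomology. -/
noncomputable def lcι (J : Ideal R) (i : ℕ) (M : ModuleCat.{u} R) (n : ℕ) :
    ((Ext R (ModuleCat.{u} R) i).obj (op (ModuleCat.of R (R ⧸ J ^ n)))).obj M →ₗ[R]
      (localCohomology J i).obj M :=
  ((colimit.ι (localCohomology.diagram (localCohomology.idealPowersDiagram J) i)
    (op (op n))).app M).hom

lemma lcι_compat (J : Ideal R) (i : ℕ) (M : ModuleCat.{u} R) {n m : ℕ} (h : n ≤ m)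
    (x : ((Ext R (ModuleCat.{u} R) i).obj (op (ModuleCat.of R (R ⧸ J ^ n)))).obj M) :
    lcι J i M m ((((Ext R (ModuleCat.{u} R) i).map (qmap J h).op).app M).hom x) =
      lcι J i M n x := by
  have h1 := colimit.w (localCohomology.diagram (localCohomology.idealPowersDiagram J) i)
    (show (op (op n) : ℕᵒᵖᵒᵖ) ⟶ op (op m) from (homOfLE h).op.op)
  exact congrArg (fun f => (f.app M).hom x) h1

lemma lc_isColimit (J : Ideal R) (i : ℕ) (M : ModuleCat.{u} R) :
    Nonempty (IsColimit (((evaluation (ModuleCat.{u} R) (ModuleCat.{u} R)).obj M).mapCocone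
      (colimit.cocone (localCohomology.diagram (localCohomology.idealPowersDiagram J) i)))) :=
  ⟨isColimitOfPreserves _ (colimit.isColimit _)⟩

instance forget_pres (F : ℕᵒᵖᵒᵖ ⥤ ModuleCat.{u} R) :
    PreservesColimit F (forget (ModuleCat.{u} R)) := by
  have h : PreservesFilteredColimitsOfSize.{0, 0} (forget (ModuleCat.{u} R)) :=
    preservesFilteredColimitsOfSize_shrink.{0, u, 0, u} _
  have : PreservesColimitsOfShape ℕᵒᵖᵒᵖ (forget (ModuleCat.{u} R)) :=
    h.preserves_filtered_colimits _
  infer_instance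

lemma lcι_surj (J : Ideal R) (i : ℕ) (M : ModuleCat.{u} R) (h : (localCohomology J i).obj M) :
    ∃ n x, lcι J i M n x = h := by
  obtain ⟨hc⟩ := lc_isColimit J i M
  obtain ⟨j, y, hy⟩ := Concrete.isColimit_exists_rep _ hc h
  exact ⟨j.unop.unop, y, hy⟩

lemma lcι_zero (J : Ideal R) (i : ℕ) (M : ModuleCat.{u} R) (n : ℕ)
    (x : ((Ext R (ModuleCat.{u} R) i).obj (op (ModuleCat.of R (R ⧸ J ^ n)))).obj M)
    (hx : lcι J i M n x = 0) : ∃ (m : ℕ) (h : n ≤ m),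
      (((Ext R (ModuleCat.{u} R) i).map (qmap J h).op).app M).hom x = 0 := by
  obtain ⟨hc⟩ := lc_isColimit J i M
  obtain ⟨k, f, g, hfg⟩ := Concrete.isColimit_exists_of_rep_eq
    (localCohomology.diagram (localCohomology.idealPowersDiagram J) i ⋙
      (evaluation (ModuleCat.{u} R) (ModuleCat.{u} R)).obj M) hc (i := op (op n)) (j := op (op n))
    x 0 (hx.trans (LinearMap.map_zero (lcι J i M n)).symm)
  refine ⟨k.unop.unop, f.unop.unop.down.down, ?_⟩
  exact hfg.trans (LinearMap.map_zero (ModuleCat.Hom.hom _))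

/-- The homomorphism `R/J^n → N` determined by an element killed by `J^n`. -/
noncomputable def hm (J : Ideal R) (n : ℕ) {N : ModuleCat.{u} R} (z : N)
    (hz : ∀ r ∈ J ^ n, r • z = 0) : ModuleCat.of R (R ⧸ J ^ n) ⟶ N :=
  ModuleCat.ofHom (Submodule.liftQ _ (LinearMap.toSpanSingleton R N z) (fun r hr => hz r hr))

lemma hm_mk (J : Ideal R) (n : ℕ) {N : ModuleCat.{u} R} (z : N)
    (hz : ∀ r ∈ J ^ n, r • z = 0) (r : R) :
    (hm J n z hz).hom (Submodule.Quotient.mk r) = r • z := rfl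

lemma hom_ext_mk (J : Ideal R) (n : ℕ) {N : ModuleCat.{u} R}
    {f g : ModuleCat.of R (R ⧸ J ^ n) ⟶ N}
    (h : ∀ r : R, f.hom (Submodule.Quotient.mk r) = g.hom (Submodule.Quotient.mk r)) : f = g := by
  apply ModuleCat.hom_ext
  apply LinearMap.ext
  intro x
  obtain ⟨r, rfl⟩ := Submodule.Quotient.mk_surjective _ x
  exact h r

lemma hm_surj (J : Ideal R) (n : ℕ) {N : ModuleCat.{u} R} (f : ModuleCat.of R (R ⧸ J ^ n) ⟶ N) :
    ∃ (z : N) (hz : ∀ r ∈ J ^ n, r • z = 0), hm J n z hz = f := by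
  have key : ∀ r : R, r • f.hom (Submodule.Quotient.mk (1 : R)) =
      f.hom (Submodule.Quotient.mk r) := by
    intro r
    rw [← map_smul, ← Submodule.Quotient.mk_smul, smul_eq_mul, mul_one]
  refine ⟨f.hom (Submodule.Quotient.mk (1 : R)), fun r hr => ?_, hom_ext_mk J n fun r => ?_⟩
  · rw [key, (Submodule.Quotient.mk_eq_zero _).2 hr, map_zero]
  · rw [hm_mk, key]

lemma hm_eq_zero (J : Ideal R) (n : ℕ) {N : ModuleCat.{u} R} (z : N)
    (hz : ∀ r ∈ J ^ n, r • z = 0) : hm J n z hz = 0 ↔ z = 0 := by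
  constructor
  · intro h
    have := congrArg (fun f => f.hom (Submodule.Quotient.mk (1 : R))) h
    rw [hm_mk, one_smul] at this
    exact this
  · rintro rfl
    exact hom_ext_mk J n fun r => by rw [hm_mk, smul_zero]; rfl

lemma hm_comp (J : Ideal R) (n : ℕ) {N N' : ModuleCat.{u} R} (z : N)
    (hz : ∀ r ∈ J ^ n, r • z = 0) (f : N ⟶ N') (hz' : ∀ r ∈ J ^ n, r • f.hom z = 0) :
    hm J n z hz ≫ f = hm J n (f.hom z) hz' :=
  hom_ext_mk J n fun r => by
    rw [hm_mk]
    exact f.hom.map_smul r z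

lemma hm_inj (J : Ideal R) (n : ℕ) {N : ModuleCat.{u} R} (z w : N)
    (hz : ∀ r ∈ J ^ n, r • z = 0) (hw : ∀ r ∈ J ^ n, r • w = 0) (h : hm J n z hz = hm J n w hw) :
    z = w := by
  have := congrArg (fun f => f.hom (Submodule.Quotient.mk (1 : R))) h
  rw [hm_mk, one_smul] at this
  exact this.trans (one_smul R w)

lemma qmap_hm (J : Ideal R) {n m : ℕ} (h : n ≤ m) {N : ModuleCat.{u} R} (z : N)
    (hz : ∀ r ∈ J ^ n, r • z = 0) (hz' : ∀ r ∈ J ^ m, r • z = 0) :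
    qmap J h ≫ hm J n z hz = hm J m z hz' :=
  hom_ext_mk J m fun _ => rfl

section
variable {M : ModuleCat.{u} R} (I : InjectiveResolution M) (J : Ideal R) (i : ℕ)

lemma hm_cocycle (n : ℕ) (z : I.cocomplex.X i)
    (hz : ∀ r ∈ J ^ n, r • z = 0) (hd : (I.cocomplex.d i (i + 1)).hom z = 0) :
    hm J n z hz ≫ I.cocomplex.d i (i + 1) = 0 :=
  hom_ext_mk J n fun r => by
    refine ((I.cocomplex.d i (i + 1)).hom.map_smul r z).trans ?_
    rw [hd, smul_zero]
    rfl

/-- The local cohomology class of a torsion cocycle. -/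
noncomputable def ec (n : ℕ) (z : I.cocomplex.X i)
    (hz : ∀ r ∈ J ^ n, r • z = 0) (hd : (I.cocomplex.d i (i + 1)).hom z = 0) :
    (localCohomology J i).obj M :=
  lcι J i M n ((beta _ M i).symm
    (I.extMk (hm J n z hz) (i + 1) rfl (hm_cocycle I J i n z hz hd)))

lemma extMk_congr {L : ModuleCat.{u} R} {f g : L ⟶ I.cocomplex.X i} (h : f = g) (m : ℕ)
    (hm : i + 1 = m) (hf : f ≫ I.cocomplex.d i m = 0) (hg : g ≫ I.cocomplex.d i m = 0) :
    I.extMk f m hm hf = I.extMk g m hm hg := by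
  subst h; rfl

lemma lcmap_beta {n m : ℕ} (h : n ≤ m) (z : I.cocomplex.X i)
    (hz : ∀ r ∈ J ^ n, r • z = 0) (hd : (I.cocomplex.d i (i + 1)).hom z = 0)
    (hz' : ∀ r ∈ J ^ m, r • z = 0) :
    (((Ext R (ModuleCat.{u} R) i).map (qmap J h).op).app M).hom ((beta _ M i).symm
      (I.extMk (hm J n z hz) (i + 1) rfl (hm_cocycle I J i n z hz hd))) =
    (beta _ M i).symm
      (I.extMk (hm J m z hz') (i + 1) rfl (hm_cocycle I J i m z hz' hd)) := by
  apply (beta _ M i).injective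
  rw [beta_nat, LinearEquiv.apply_symm_apply, LinearEquiv.apply_symm_apply,
    InjectiveResolution.mk₀_comp_extMk]
  exact extMk_congr I i (qmap_hm J h z hz hz') _ _ _ _

lemma ec_indep {n m : ℕ} (h : n ≤ m) (z : I.cocomplex.X i)
    (hz : ∀ r ∈ J ^ n, r • z = 0) (hd : (I.cocomplex.d i (i + 1)).hom z = 0)
    (hz' : ∀ r ∈ J ^ m, r • z = 0) : ec I J i n z hz hd = ec I J i m z hz' hd := by
  unfold ec
  rw [← lcι_compat J i M h, lcmap_beta I J i h z hz hd hz']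

lemma ec_indep' {n m : ℕ} (z : I.cocomplex.X i)
    (hz : ∀ r ∈ J ^ n, r • z = 0) (hd : (I.cocomplex.d i (i + 1)).hom z = 0)
    (hz' : ∀ r ∈ J ^ m, r • z = 0) : ec I J i n z hz hd = ec I J i m z hz' hd := by
  rcases le_total n m with h | h
  · exact ec_indep I J i h z hz hd hz'
  · exact (ec_indep I J i h z hz' hd hz).symm

lemma ec_add (n : ℕ) (z w : I.cocomplex.X i)
    (hz : ∀ r ∈ J ^ n, r • z = 0) (hd : (I.cocomplex.d i (i + 1)).hom z = 0)
    (hw : ∀ r ∈ J ^ n, r • w = 0) (hd' : (I.cocomplex.d i (i + 1)).hom w = 0)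
    (hs : ∀ r ∈ J ^ n, r • (z + w) = 0) (hds : (I.cocomplex.d i (i + 1)).hom (z + w) = 0) :
    ec I J i n (z + w) hs hds = ec I J i n z hz hd + ec I J i n w hw hd' := by
  have h1 : I.extMk (hm J n (z + w) hs) (i + 1) rfl (hm_cocycle I J i n (z + w) hs hds) =
      I.extMk (hm J n z hz) (i + 1) rfl (hm_cocycle I J i n z hz hd) +
      I.extMk (hm J n w hw) (i + 1) rfl (hm_cocycle I J i n w hw hd') := by
    rw [InjectiveResolution.add_extMk]
    exact extMk_congr I i (hom_ext_mk J n fun r => smul_add r z w) _ _ _ _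
  unfold ec
  rw [h1, map_add, map_add]

lemma ec_smul (n : ℕ) (a : R) (z : I.cocomplex.X i)
    (hz : ∀ r ∈ J ^ n, r • z = 0) (hd : (I.cocomplex.d i (i + 1)).hom z = 0)
    (hs : ∀ r ∈ J ^ n, r • (a • z) = 0) (hds : (I.cocomplex.d i (i + 1)).hom (a • z) = 0) :
    ec I J i n (a • z) hs hds = a • ec I J i n z hz hd := by
  unfold ec
  rw [← map_smul, ← map_smul]
  congr 2
  have h1 : a • I.extMk (hm J n z hz) (i + 1) rfl (hm_cocycle I J i n z hz hd) =
      (Abelian.Ext.mk₀ (a • 𝟙 _)).comp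
        (I.extMk (hm J n z hz) (i + 1) rfl (hm_cocycle I J i n z hz hd)) (zero_add _) := by
    rw [Abelian.Ext.mk₀_smul, Abelian.Ext.smul_comp, Abelian.Ext.mk₀_id_comp]
  rw [h1, InjectiveResolution.mk₀_comp_extMk]
  refine extMk_congr I i (hom_ext_mk J n fun r => ?_) _ _ _ _
  rw [Linear.smul_comp, Category.id_comp]
  exact smul_comm r a z

lemma ec_surj (h : (localCohomology J i).obj M) : ∃ n z hz hd, ec I J i n z hz hd = h := by
  obtain ⟨n, x, rfl⟩ := lcι_surj J i M h
  obtain ⟨y, rfl⟩ := (beta _ M i).symm.surjective x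
  obtain ⟨f, hf, rfl⟩ := I.extMk_surjective y (i + 1) rfl
  obtain ⟨z, hz, rfl⟩ := hm_surj J n f
  refine ⟨n, z, hz, ?_, rfl⟩
  have := congrArg (fun f => f.hom (Submodule.Quotient.mk (1 : R))) hf
  have h2 : (hm J n z hz).hom (Submodule.Quotient.mk (1 : R)) = z := by rw [hm_mk, one_smul]
  exact (congrArg (I.cocomplex.d i (i + 1)).hom h2).symm.trans this

lemma ec_zero_iff (n : ℕ) (z : I.cocomplex.X i)
    (hz : ∀ r ∈ J ^ n, r • z = 0) (hd : (I.cocomplex.d i (i + 1)).hom z = 0) :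
    ec I J i n z hz hd = 0 ↔ ∃ (m : ℕ) (hz' : ∀ r ∈ J ^ m, r • z = 0),
      I.extMk (hm J m z hz') (i + 1) rfl (hm_cocycle I J i m z hz' hd) = 0 := by
  constructor
  · intro h
    obtain ⟨m, hnm, h1⟩ := lcι_zero J i M n _ h
    have hz' : ∀ r ∈ J ^ m, r • z = 0 := fun r hr => hz r (Ideal.pow_le_pow_right hnm hr)
    refine ⟨m, hz', ?_⟩
    rw [lcmap_beta I J i hnm z hz hd hz'] at h1
    exact ((beta _ M i).symm.map_eq_zero_iff).1 h1
  · rintro ⟨m, hz', h⟩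
    rw [ec_indep' I J i z hz hd hz']
    unfold ec
    rw [h, map_zero, map_zero]
end

lemma ec_zero_zero {M : ModuleCat.{u} R} (I : InjectiveResolution M) (J : Ideal R)
    (n : ℕ) (z : I.cocomplex.X 0)
    (hz : ∀ r ∈ J ^ n, r • z = 0) (hd : (I.cocomplex.d 0 1).hom z = 0) :
    ec I J 0 n z hz hd = 0 ↔ z = 0 := by
  rw [ec_zero_iff]
  constructor
  · rintro ⟨m, hz', h⟩
    rw [injExtMk_zero_iff, hm_eq_zero] at h
    exact h
  · rintro rfl
    refine ⟨n, hz, ?_⟩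
    rw [injExtMk_zero_iff, hm_eq_zero]

lemma ec_succ_zero {M : ModuleCat.{u} R} (I : InjectiveResolution M) (J : Ideal R) (p : ℕ)
    (n : ℕ) (z : I.cocomplex.X (p + 1))
    (hz : ∀ r ∈ J ^ n, r • z = 0) (hd : (I.cocomplex.d (p + 1) (p + 2)).hom z = 0) :
    ec I J (p + 1) n z hz hd = 0 ↔
      ∃ b ∈ tors J (I.cocomplex.X p), (I.cocomplex.d p (p + 1)).hom b = z := by
  rw [ec_zero_iff]
  constructor
  · rintro ⟨m, hz', h⟩
    rw [InjectiveResolution.extMk_eq_zero_iff _ _ _ _ _ p rfl] at h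
    obtain ⟨g, hg⟩ := h
    obtain ⟨b, hb, rfl⟩ := hm_surj J m g
    refine ⟨b, ⟨m, hb⟩, ?_⟩
    have hb' : ∀ r ∈ J ^ m, r • (I.cocomplex.d p (p + 1)).hom b = 0 := fun r hr => by
      rw [← map_smul, hb r hr, map_zero]
    rw [hm_comp J m b hb _ hb'] at hg
    exact hm_inj J m _ _ _ _ hg
  · rintro ⟨b, ⟨m, hb⟩, rfl⟩
    have hb' : ∀ r ∈ J ^ m, r • (I.cocomplex.d p (p + 1)).hom b = 0 := fun r hr => by
      rw [← map_smul, hb r hr, map_zero]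
    refine ⟨m, hb', ?_⟩
    rw [InjectiveResolution.extMk_eq_zero_iff _ _ _ _ _ p rfl]
    exact ⟨hm J m b hb, hm_comp J m b hb _ hb'⟩

end GCM


namespace GCM
open CategoryTheory CategoryTheory.Limits Opposite

variable {R : Type u} [CommRing R]

/-- The complex of modules underlying an injective resolution. -/
noncomputable def icpx {M : ModuleCat.{u} R} (I : InjectiveResolution M) : Cpx R where
  X n := I.cocomplex.X n
  d n := (I.cocomplex.d n (n + 1)).hom
  dd n z := by
    have := congrArg (fun f => f.hom z) (I.cocomplex.d_comp_d n (n + 1) (n + 2))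
    exact this

/-- The torsion subcomplex. -/
def tcpx (J : Ideal R) (D : Cpx R) : Cpx R where
  X n := tors J (D.X n)
  d n := (D.d n).restrict (fun _ hz => map_tors J (D.d n) hz)
  dd n z := Subtype.ext (D.dd n z.1)

/-- The torsion pair. -/
def tpair (J : Ideal R) (D : Cpx R) (h : ∀ n, Module.Injective R (D.X n)) :
    Cpx.GPair J (tcpx J D) D where
  f n := (tors J (D.X n)).subtype
  comm n z := rfl
  inj n := Subtype.val_injective
  rng n := Submodule.range_subtype _
  injD := h

/-- Comparison map from torsion cocycles to local cohomology. -/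
noncomputable def theta {M : ModuleCat.{u} R} (I : InjectiveResolution M) (J : Ideal R) (i : ℕ)
    (z : LinearMap.ker ((tcpx J (icpx I)).d i)) : (localCohomology J i).obj M :=
  ec I J i (mem_tors.1 z.1.2).choose z.1.1 (mem_tors.1 z.1.2).choose_spec
    (congrArg Subtype.val z.2)

lemma theta_eq {M : ModuleCat.{u} R} (I : InjectiveResolution M) (J : Ideal R) (i : ℕ)
    (z : LinearMap.ker ((tcpx J (icpx I)).d i)) (n : ℕ) (y : I.cocomplex.X i) (hy : z.1.1 = y)
    (hz : ∀ r ∈ J ^ n, r • y = 0) (hd : (I.cocomplex.d i (i + 1)).hom y = 0) :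
    theta I J i z = ec I J i n y hz hd := by
  subst hy
  exact ec_indep' I J i _ _ _ _

/-- Comparison map from torsion cocycles to local cohomology, as a linear map. -/
noncomputable def thetaL {M : ModuleCat.{u} R} (I : InjectiveResolution M) (J : Ideal R) (i : ℕ) :
    LinearMap.ker ((tcpx J (icpx I)).d i) →ₗ[R] (localCohomology J i).obj M where
  toFun := theta I J i
  map_add' z w := by
    obtain ⟨s, hs⟩ := mem_tors.1 z.1.2
    obtain ⟨t, ht⟩ := mem_tors.1 w.1.2
    have hs' : ∀ r ∈ J ^ (s + t), r • (z.1.1 : I.cocomplex.X i) = 0 := fun r hr =>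
      hs r (Ideal.pow_le_pow_right (by omega) hr)
    have ht' : ∀ r ∈ J ^ (s + t), r • (w.1.1 : I.cocomplex.X i) = 0 := fun r hr =>
      ht r (Ideal.pow_le_pow_right (by omega) hr)
    have hst : ∀ r ∈ J ^ (s + t), r • (z.1.1 + w.1.1 : I.cocomplex.X i) = 0 := fun r hr => by
      rw [smul_add, hs' r hr, ht' r hr, add_zero]
    rw [theta_eq I J i z (s + t) _ rfl hs' (congrArg Subtype.val z.2),
      theta_eq I J i w (s + t) _ rfl ht' (congrArg Subtype.val w.2),
      theta_eq I J i (z + w) (s + t) (z.1.1 + w.1.1 : I.cocomplex.X i) rfl hst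
        (congrArg Subtype.val (z + w).2)]
    exact ec_add I J i (s + t) _ _ _ _ _ _ _ _
  map_smul' a z := by
    obtain ⟨s, hs⟩ := mem_tors.1 z.1.2
    have hst : ∀ r ∈ J ^ s, r • (a • z.1.1 : I.cocomplex.X i) = 0 := fun r hr =>
      (smul_comm r a (z.1.1 : I.cocomplex.X i)).trans
        ((congrArg (a • ·) (hs r hr)).trans (smul_zero a))
    rw [theta_eq I J i z s _ rfl hs (congrArg Subtype.val z.2),
      theta_eq I J i (a • z) s (a • z.1.1 : I.cocomplex.X i) rfl hst
        (congrArg Subtype.val (a • z).2)]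
    exact ec_smul I J i s a _ _ _ _ _

lemma thetaL_surj {M : ModuleCat.{u} R} (I : InjectiveResolution M) (J : Ideal R) (i : ℕ) :
    Function.Surjective (thetaL I J i) := by
  intro h
  obtain ⟨n, z, hz, hd, rfl⟩ := ec_surj I J i h
  exact ⟨⟨⟨z, ⟨n, hz⟩⟩, Subtype.ext hd⟩, theta_eq I J i _ n z rfl hz hd⟩

lemma lc_equiv {M : ModuleCat.{u} R} (I : InjectiveResolution M) (J : Ideal R) (i : ℕ) :
    Nonempty ((tcpx J (icpx I)).shift.H i ≃ₗ[R] (localCohomology J i).obj M) := by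
  let C := (tcpx J (icpx I)).shift
  obtain ⟨e, -⟩ := exists_equiv_of_ker (R := R) (Z := LinearMap.ker (C.d (i + 1))) (A := C.H i)
    (B := (localCohomology J i).obj M) (Submodule.mkQ _)
    (thetaL I J i) (Submodule.mkQ_surjective _) (thetaL_surj I J i) (by
      intro z
      refine (Cpx.cls_eq_zero C i z.1 z.2).trans ?_
      obtain ⟨s, hs⟩ := mem_tors.1 (show (z.1 : tors J (I.cocomplex.X i)).1 ∈ _ from
        (z.1 : tors J (I.cocomplex.X i)).2)
      have h1 := theta_eq I J i z s _ rfl hs (congrArg Subtype.val z.2)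
      have h2 : thetaL I J i z = 0 ↔ ec I J i s _ hs (congrArg Subtype.val z.2) = 0 :=
        ⟨fun h => h1.symm.trans h, fun h => h1.trans h⟩
      refine Iff.trans ?_ h2.symm
      cases i with
      | zero =>
        refine Iff.trans ?_ (ec_zero_zero I J s _ hs _).symm
        constructor
        · rintro ⟨e, he⟩
          exact (congrArg (Subtype.val : tors J (I.cocomplex.X 0) → _) he).symm
        · intro h
          exact ⟨PUnit.unit, (Subtype.ext h : z.1 = (0 : tors J (I.cocomplex.X 0))).symm⟩
      | succ p =>
        refine Iff.trans ?_ (ec_succ_zero I J p s _ hs _).symm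
        constructor
        · rintro ⟨e, he⟩
          exact ⟨(e : tors J (I.cocomplex.X p)).1, (e : tors J (I.cocomplex.X p)).2,
            congrArg (Subtype.val : tors J (I.cocomplex.X (p + 1)) → _) he⟩
        · rintro ⟨b, hb, h⟩
          exact ⟨(⟨b, hb⟩ : tors J (I.cocomplex.X p)), Subtype.ext h⟩)
  exact ⟨e⟩

lemma icpx_inj {M : ModuleCat.{u} R} (I : InjectiveResolution M) (n : ℕ) :
    Module.Injective R ((icpx I).X n) :=
  (Module.injective_iff_injective_object R _).2 (I.injective n)

lemma icpx_sub {M : ModuleCat.{u} R} (I : InjectiveResolution M) (n : ℕ) :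
    Subsingleton ((icpx I).shift.H (n + 1)) := by
  refine subsingleton_of_forall_eq 0 (fun h => ?_)
  obtain ⟨z, hz, rfl⟩ := Cpx.cls_surj _ _ h
  rw [Cpx.cls_eq_zero]
  have hex := (ShortComplex.ShortExact.moduleCat_exact_iff_function_exact _).1 (I.exact_succ n)
  exact (hex z).1 hz

lemma icpx_zero {M : ModuleCat.{u} R} (I : InjectiveResolution M) :
    Nonempty (M ≃ₗ[R] (icpx I).shift.H 0) := by
  let C := (icpx I).shift
  let i0 : M ⟶ I.cocomplex.X 0 := I.ι.f 0
  have hi : Function.Injective i0.hom :=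
    (ModuleCat.mono_iff_injective _).1 (inferInstanceAs (Mono (I.ι.f 0)))
  have hw : i0 ≫ I.cocomplex.d 0 1 = 0 := I.ι_f_zero_comp_complex_d
  have hex : (ShortComplex.mk _ _ hw).Exact :=
    ShortComplex.exact_of_f_is_kernel _ I.isLimitKernelFork
  have hfe := (ShortComplex.ShortExact.moduleCat_exact_iff_function_exact _).1 hex
  let w : LinearMap.ker (C.d 1) →ₗ[R] C.H 0 := Submodule.mkQ _
  let v : M →ₗ[R] LinearMap.ker (C.d 1) := LinearMap.codRestrict _ i0.hom (fun x =>
    (hfe _).2 ⟨x, rfl⟩)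
  refine ⟨LinearEquiv.ofBijective (w ∘ₗ v) ⟨?_, ?_⟩⟩
  · rw [← LinearMap.ker_eq_bot, LinearMap.ker_eq_bot']
    intro x hx
    obtain ⟨e, he⟩ := (Cpx.cls_eq_zero C 0 (v x).1 (v x).2).1 hx
    exact hi (he.symm.trans (LinearMap.map_zero i0.hom).symm)
  · intro h
    obtain ⟨z, hz, rfl⟩ := Cpx.cls_surj _ _ h
    obtain ⟨x, hx⟩ := (hfe z).1 hz
    refine ⟨x, ?_⟩
    exact congrArg (Submodule.mkQ _) (Subtype.ext hx : v x = ⟨z, hz⟩)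

theorem exists_cpx (J : Ideal R) (M : Type u) [AddCommGroup M] [Module R M] :
    ∃ E C : Cpx R, Nonempty (Cpx.GPair J C E) ∧ Subsingleton (E.X 0) ∧
      Nonempty (M ≃ₗ[R] E.H 0) ∧ (∀ i, Subsingleton (E.H (i + 1))) ∧
      ∀ i, Nonempty (C.H i ≃ₗ[R] (localCohomology J i).obj (ModuleCat.of R M)) := by
  let I := injectiveResolution (ModuleCat.of R M)
  exact ⟨(icpx I).shift, (tcpx J (icpx I)).shift, ⟨(tpair J _ (icpx_inj I)).shift⟩,
    inferInstanceAs (Subsingleton PUnit), icpx_zero I, icpx_sub I, lc_equiv I J⟩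

end GCM


namespace GCM

section
variable {R : Type u} [CommRing R] [IsLocalRing R]

lemma exists_pow_kill (H : Type u) [AddCommGroup H] [Module R H] (h : IsFiniteLength R H) :
    ∃ n : ℕ, ∀ r ∈ maximalIdeal R ^ n, ∀ z : H, r • z = 0 := by
  obtain ⟨h1, h2⟩ := isFiniteLength_iff_isNoetherian_isArtinian.1 h
  let f : ℕ →o (Submodule R H)ᵒᵈ :=
    ⟨fun n => OrderDual.toDual ((maximalIdeal R ^ n) • (⊤ : Submodule R H)), fun a b hab =>
      Submodule.smul_mono_left (Ideal.pow_le_pow_right hab)⟩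
  obtain ⟨n, hn⟩ := IsArtinian.monotone_stabilizes f
  have h3 : (maximalIdeal R ^ n) • (⊤ : Submodule R H) =
      (maximalIdeal R ^ (n + 1)) • (⊤ : Submodule R H) := hn (n + 1) (by omega)
  have h4 : (maximalIdeal R ^ n) • (⊤ : Submodule R H) = ⊥ := by
    apply Submodule.eq_bot_of_le_smul_of_le_jacobson_bot (maximalIdeal R) _
      (IsNoetherian.noetherian _) _ (maximalIdeal_le_jacobson _)
    rw [← mul_smul, ← pow_succ']
    exact h3.le
  refine ⟨n, fun r hr z => ?_⟩
  have := Submodule.smul_mem_smul hr (Submodule.mem_top : z ∈ (⊤ : Submodule R H))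
  rw [h4] at this
  exact (Submodule.mem_bot R).1 this

lemma le_radical_of_fl (M : Type u) [AddCommGroup M] [Module R M] [Module.Finite R M]
    (q : Ideal R) (h : IsFiniteLength R (M ⧸ (q • ⊤ : Submodule R M))) :
    maximalIdeal R ≤ (Module.annihilator R M ⊔ q).radical := by
  obtain ⟨n, hn⟩ := exists_pow_kill _ h
  have h1 : Module.support R (M ⧸ (q • ⊤ : Submodule R M)) =
      Module.support R M ∩ PrimeSpectrum.zeroLocus q := Module.support_quotient q
  rw [Module.support_eq_zeroLocus, Module.support_eq_zeroLocus, ← PrimeSpectrum.zeroLocus_sup,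
    PrimeSpectrum.zeroLocus_eq_iff] at h1
  rw [← h1]
  intro r hr
  refine ⟨n, ?_⟩
  rw [Module.mem_annihilator]
  exact fun z => hn _ (Ideal.pow_mem_pow hr n) z

lemma fl_of_le_radical [IsNoetherianRing R] (M : Type u) [AddCommGroup M] [Module R M]
    [Module.Finite R M] (q : Ideal R)
    (h : maximalIdeal R ≤ (Module.annihilator R M ⊔ q).radical) :
    IsFiniteLength R (M ⧸ (q • ⊤ : Submodule R M)) := by
  rw [isFiniteLength_iff_isNoetherian_isArtinian]
  refine ⟨inferInstance, ?_⟩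
  set I := Module.annihilator R M ⊔ q with hI
  have hann : ∀ r ∈ I, ∀ z : M ⧸ (q • ⊤ : Submodule R M), r • z = 0 := by
    intro r hr z
    obtain ⟨a, ha, b, hb, rfl⟩ := Submodule.mem_sup.1 hr
    obtain ⟨w, rfl⟩ := Submodule.Quotient.mk_surjective _ z
    rw [← Submodule.Quotient.mk_smul, Submodule.Quotient.mk_eq_zero, add_smul,
      Module.mem_annihilator.1 ha, zero_add]
    exact Submodule.smul_mem_smul hb Submodule.mem_top
  by_cases htop : I = ⊤
  · have : Subsingleton (M ⧸ (q • ⊤ : Submodule R M)) :=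
      subsingleton_of_forall_eq 0 (fun z => by
        have := hann 1 (by rw [htop]; trivial) z
        rwa [one_smul] at this)
    infer_instance
  have hmin : maximalIdeal R ∈ I.minimalPrimes := by
    refine ⟨⟨inferInstance, le_maximalIdeal htop⟩, fun p hp _ => ?_⟩
    have := hp.1
    exact h.trans ((Ideal.radical_mono hp.2).trans this.radical.le)
  have hart := IsLocalRing.quotient_artinian_of_mem_minimalPrimes_of_isLocalRing I hmin
  let N := M ⧸ (q • ⊤ : Submodule R M)
  have htor : Module.IsTorsionBySet R N (I : Set R) := fun z r => hann r.1 r.2 z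
  let _ : Module (R ⧸ I) N := htor.module
  have : IsScalarTower R (R ⧸ I) N := htor.isScalarTower
  have : Module.Finite (R ⧸ I) N := Module.Finite.of_restrictScalars_finite R (R ⧸ I) N
  have h3 : IsArtinian (R ⧸ I) N := inferInstance
  have : IsArtinian R N := isArtinian_of_surjective_algebraMap (R := R ⧸ I) Ideal.Quotient.mk_surjective
  exact this

lemma exists_sop [IsNoetherianRing R] (M : Type u) [AddCommGroup M] [Module R M]
    [Module.Finite R M] (d : ℕ)
    (hdim : ringKrullDim (R ⧸ Module.annihilator R M) = d) (n : ℕ) (hn : 0 < n) :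
    ∃ x : Fin d → R, (∀ i, x i ∈ maximalIdeal R) ∧
      IsFiniteLength R (M ⧸ (Ideal.span (Set.range x) • ⊤ : Submodule R M)) ∧
      Ideal.span (Set.range x) ≤ maximalIdeal R ^ n := by
  set A := Module.annihilator R M with hA
  have hnt : Nontrivial (R ⧸ A) := by
    by_contra hc
    rw [not_nontrivial_iff_subsingleton] at hc
    rw [ringKrullDim_eq_bot_of_subsingleton] at hdim
    exact absurd hdim (by simp)
  have hloc : IsLocalRing (R ⧸ A) :=
    IsLocalRing.of_surjective' (Ideal.Quotient.mk A) Ideal.Quotient.mk_surjective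
  obtain ⟨s, hs1, hs2⟩ :=
    Ideal.exists_finset_card_eq_height_of_isNoetherianRing (maximalIdeal (R ⧸ A))
  have hcard : s.card = d := by
    have h := IsLocalRing.maximalIdeal_height_eq_ringKrullDim (R := R ⧸ A)
    rw [hdim, ← hs2] at h
    exact_mod_cast h
  let e := s.equivFinOfCardEq hcard
  choose g hg using (Ideal.Quotient.mk_surjective : Function.Surjective (Ideal.Quotient.mk A))
  let y : Fin d → R := fun i => g (e.symm i).1
  have hy : ∀ i, Ideal.Quotient.mk A (y i) = (e.symm i).1 := fun i => hg _
  have hym : ∀ i, y i ∈ maximalIdeal R := by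
    intro i
    have h1 : (e.symm i).1 ∈ maximalIdeal (R ⧸ A) :=
      hs1.1.2 (Ideal.subset_span (e.symm i).2)
    rw [mem_maximalIdeal, mem_nonunits_iff] at h1 ⊢
    intro hu
    apply h1
    rw [← hy i]
    exact hu.map _
  have hspan : Ideal.map (Ideal.Quotient.mk A) (A ⊔ Ideal.span (Set.range y)) =
      Ideal.span (s : Set (R ⧸ A)) := by
    rw [Ideal.map_sup, Ideal.map_quotient_self, bot_sup_eq, Ideal.map_span]
    congr 1
    ext t
    constructor
    · rintro ⟨_, ⟨i, rfl⟩, rfl⟩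
      rw [hy]
      exact (e.symm i).2
    · intro ht
      refine ⟨y (e ⟨t, ht⟩), ⟨_, rfl⟩, ?_⟩
      rw [hy, Equiv.symm_apply_apply]
  have hrad : maximalIdeal R ≤ (A ⊔ Ideal.span (Set.range y)).radical := by
    rw [Ideal.radical_eq_sInf]
    refine le_sInf fun p hp => ?_
    obtain ⟨hp1, hp2⟩ := hp
    have hAp : A ≤ p := le_sup_left.trans hp1
    have hker : RingHom.ker (Ideal.Quotient.mk A) ≤ p := by rwa [Ideal.mk_ker]
    have hpp : (p.map (Ideal.Quotient.mk A)).IsPrime :=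
      Ideal.map_isPrime_of_surjective Ideal.Quotient.mk_surjective hker
    have h1 : Ideal.span (s : Set (R ⧸ A)) ≤ p.map (Ideal.Quotient.mk A) := by
      rw [← hspan]; exact Ideal.map_mono hp1
    have h2 : maximalIdeal (R ⧸ A) ≤ p.map (Ideal.Quotient.mk A) :=
      hs1.2 ⟨hpp, h1⟩ (le_maximalIdeal hpp.ne_top)
    intro r hr
    have h3 : Ideal.Quotient.mk A r ∈ maximalIdeal (R ⧸ A) := by
      rw [mem_maximalIdeal, mem_nonunits_iff]
      intro hu
      have := IsLocalHom.of_surjective (Ideal.Quotient.mk A) Ideal.Quotient.mk_surjective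
      exact hr (isUnit_of_map_unit _ _ hu)
    have h4 := Ideal.mem_comap.2 (h2 h3)
    rwa [Ideal.comap_map_of_surjective' _ Ideal.Quotient.mk_surjective, Ideal.mk_ker,
      sup_eq_left.2 hAp] at h4
  refine ⟨fun i => y i ^ n, fun i => Ideal.pow_mem_of_mem _ (hym i) n hn, ?_, ?_⟩
  · apply fl_of_le_radical
    refine hrad.trans ?_
    rw [Ideal.radical_le_radical_iff]
    refine sup_le (le_sup_left.trans Ideal.le_radical) ?_
    rw [Ideal.span_le]
    rintro _ ⟨i, rfl⟩
    exact ⟨n, Ideal.mem_sup_right (Ideal.subset_span ⟨i, rfl⟩)⟩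
  · rw [Ideal.span_le]
    rintro _ ⟨i, rfl⟩
    exact Ideal.pow_mem_pow (hym i) n

lemma soclen_ne_top (m : Ideal R) (N : Type u) [AddCommGroup N] [Module R N]
    (h : IsFiniteLength R N) : soclen m N ≠ ⊤ := by
  obtain ⟨h1, h2⟩ := isFiniteLength_iff_isNoetherian_isArtinian.1 h
  unfold soclen
  rw [Module.length_ne_top_iff, isFiniteLength_iff_isNoetherian_isArtinian]
  exact ⟨inferInstance, inferInstance⟩

lemma toNat_sum_mul (d : ℕ) (a : ℕ → ℕ∞) (t : ℕ∞) (ht : t ≠ ⊤)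
    (h : t = ∑ i ∈ Finset.range (d + 1), (d.choose i : ℕ∞) * a i) :
    t.toNat = ∑ i ∈ Finset.range (d + 1), d.choose i * (a i).toNat := by
  have hfin : ∀ i ∈ Finset.range (d + 1), (d.choose i : ℕ∞) * a i ≠ ⊤ := by
    intro i hi hc
    have := Finset.single_le_sum (f := fun i => (d.choose i : ℕ∞) * a i)
      (fun _ _ => bot_le) hi
    rw [← h] at this
    simp only [hc, top_le_iff] at this
    exact ht this
  have h2 : (∑ i ∈ Finset.range (d + 1), (d.choose i : ℕ∞) * a i) =
      ((∑ i ∈ Finset.range (d + 1), d.choose i * (a i).toNat : ℕ) : ℕ∞) := by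
    push_cast
    refine Finset.sum_congr rfl fun i hi => ?_
    by_cases hai : a i = ⊤
    · exfalso
      apply hfin i hi
      rw [hai, ENat.mul_top]
      have := Nat.choose_pos (Nat.lt_succ_iff.1 (Finset.mem_range.1 hi))
      exact_mod_cast this.ne'
    · rw [ENat.natCast_toNat hai]
  rw [h, h2, ENat.toNat_natCast]

theorem exists_formula [IsNoetherianRing R] (M : Type u) [AddCommGroup M] [Module R M]
    [Module.Finite R M] (d : ℕ)
    (hG : ∀ i < d, IsFiniteLength R
      ((localCohomology (maximalIdeal R) i).obj (ModuleCat.of R M))) :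
    ∃ N : ℕ, ∀ x : Fin d → R,
      IsFiniteLength R (M ⧸ (Ideal.span (Set.range x) • ⊤ : Submodule R M)) →
      Ideal.span (Set.range x) ≤ maximalIdeal R ^ N →
      (soclen (maximalIdeal R) (M ⧸ (Ideal.span (Set.range x) • ⊤ : Submodule R M))).toNat =
        ∑ i ∈ Finset.range (d + 1), d.choose i * (soclen (maximalIdeal R)
          ((localCohomology (maximalIdeal R) i).obj (ModuleCat.of R M))).toNat := by
  obtain ⟨E, C, ⟨P⟩, h0, ⟨φ⟩, hs, he⟩ := exists_cpx (maximalIdeal R) M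
  have h1 : ∀ i, ∃ n : ℕ, i < d → ∀ r ∈ maximalIdeal R ^ n, ∀ z :
      (localCohomology (maximalIdeal R) i).obj (ModuleCat.of R M), r • z = 0 := by
    intro i
    by_cases hi : i < d
    · obtain ⟨n, hn⟩ := exists_pow_kill _ (hG i hi)
      exact ⟨n, fun _ => hn⟩
    · exact ⟨0, fun h => absurd h hi⟩
  choose f hf using h1
  let n0 := (∑ i ∈ Finset.range d, f i) + 1
  have hn0 : ∀ i < d, f i ≤ n0 := fun i hi =>
    (Finset.single_le_sum (f := f) (fun _ _ => Nat.zero_le _) (Finset.mem_range.2 hi)).trans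
      (Nat.le_succ _)
  have hkill : ∀ i < d, C.Kills (maximalIdeal R ^ n0) i := by
    intro i hi y hy z hz
    obtain ⟨e⟩ := he i
    rw [← Cpx.cls_eq_zero C i (y • z) (by simp [hz]), ← Cpx.smul_cls C i y z hz]
    apply e.injective
    rw [map_smul, map_zero]
    exact hf i hi y (Ideal.pow_le_pow_right (hn0 i hi) hy) _
  refine ⟨n0 + n0, fun x hx hle => ?_⟩
  have hset : {y | y ∈ List.ofFn x} = Set.range x := by
    ext y
    simp [List.mem_ofFn]
  have hc := Cpx.core (maximalIdeal R) E C P h0 φ hs (maximalIdeal R ^ n0)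
    (Ideal.pow_le_self (by omega)) (List.ofFn x)
    (by
      intro y hy
      rw [← pow_add]
      apply hle
      apply Ideal.subset_span
      rw [← hset]
      exact hy)
    (by
      intro i hi
      rw [List.length_ofFn] at hi
      exact hkill i hi)
    (by
      rw [hset]
      exact le_radical_of_fl M _ hx)
  rw [hset, List.length_ofFn] at hc
  refine toNat_sum_mul d _ _ (soclen_ne_top _ _ hx) (hc.trans ?_)
  refine Finset.sum_congr rfl fun i _ => ?_
  obtain ⟨e⟩ := he i
  rw [soclen_congr (maximalIdeal R) e]

end
end GCM


open Paper IsLocalRing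

/-- If `M` is generalized Cohen-Macaulay then
`α(M) = Σ_{i=0}^{d} C(d,i) · dim_k Soc(H^i_m(M))`. -/
theorem stmt10 (R : Type u) [CommRing R] [IsLocalRing R] [IsNoetherianRing R]
    (hCM : IsQuotientOfCMLocalRing R)
    (M : Type u) [AddCommGroup M] [Module R M] [Module.Finite R M]
    (d : ℕ) (hd : 0 < d) (hdim : mdim R M = d)
    (hGCM : IsGenCM R M d) :
    alphaLim R M d = ∑ i ∈ Finset.range (d + 1), d.choose i * socH R M i := by
  obtain ⟨N, hN⟩ := GCM.exists_formula M d hGCM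
  set S := ∑ i ∈ Finset.range (d + 1), d.choose i * socH R M i with hS
  have key : ∀ x : Fin d → R, IsSOP R M d x →
      Ideal.span (Set.range x) ≤ maximalIdeal R ^ N → ir R M (Ideal.span (Set.range x)) = S := by
    intro x hx hx2
    refine (GCM.socDim_eq (maximalIdeal R) _).trans ((hN x hx.2 hx2).trans ?_)
    refine Finset.sum_congr rfl fun i _ => congrArg (d.choose i * ·) ?_
    exact (GCM.socDim_eq (maximalIdeal R) _).symm
  have hle : ∀ n, alphaN R M d (n + 1) ≤ S := by
    intro n
    obtain ⟨x, h1, h2, h3⟩ := GCM.exists_sop M d hdim (max (n + 1) N) (by omega)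
    refine Nat.sInf_le ⟨x, ⟨h1, h2⟩, h3.trans (Ideal.pow_le_pow_right (le_max_left _ _)), ?_⟩
    exact (key x ⟨h1, h2⟩ (h3.trans (Ideal.pow_le_pow_right (le_max_right _ _)))).symm
  have heq : alphaN R M d (N + 1) = S := by
    obtain ⟨x, h1, h2, h3⟩ := GCM.exists_sop M d hdim (N + 1) (by omega)
    have hne : {r : ℕ | ∃ x : Fin d → R, IsSOP R M d x ∧
        Ideal.span (Set.range x) ≤ (maximalIdeal R) ^ (N + 1) ∧
        r = ir R M (Ideal.span (Set.range x))}.Nonempty := ⟨_, x, ⟨h1, h2⟩, h3, rfl⟩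
    obtain ⟨y, hy1, hy2, hy3⟩ := Nat.sInf_mem hne
    exact hy3.trans (key y hy1 (hy2.trans (Ideal.pow_le_pow_right (Nat.le_succ N))))
  refine le_antisymm (ciSup_le hle) ?_
  have hb : BddAbove (Set.range fun n : ℕ => alphaN R M d (n + 1)) :=
    ⟨S, by rintro _ ⟨n, rfl⟩; exact hle n⟩
  exact heq.symm.le.trans (le_ciSup hb N)
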